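/- For every single-sink network N (on an arbitrary finite directed graph, with right-constant, piecewise constant network inflow rates having finitely many jump points and bounded support), there exists an instantaneous dynamic equilibrium (IDE) flow in N that has only finitely many phases; in particular, all edge inflow and outflow rates of this IDE are piecewise constant functions with finitely many pieces. -/

import Mathlib

open MeasureTheory Set

/-- A walk in a directed graph given by `tail`/`head` maps: `IsWalk tail head v w L`
means the list of edges `L` forms a walk from `v` to `w`. -/
def IsWalk {V E : Type} (tail head : E → V) : V → V → List E → Prop
  | v, w, [] => v = w
  | v, w, e :: L => tail e = v ∧ IsWalk tail head (head e) w L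

/-- A right-constant step function with finitely many jump points. -/
def RightConstantStep (g : ℝ → ℝ) : Prop :=
  ∃ s : Finset ℝ, ∀ x y : ℝ, x ≤ y → (∀ p ∈ s, ¬ (x < p ∧ p ≤ y)) → g x = g y

/-- A single-sink network: a finite directed graph with positive rational capacities
and travel times, a sink reachable from every node, and nonnegative rational-valued
right-constant step network inflow rates (zero at the sink and for negative times). -/
structure Network (V E : Type) [Fintype V] [DecidableEq V] [Fintype E] [DecidableEq E] where
  tail : E → V
  head : E → V
  cap : E → ℝ
  time : E → ℝ
  sink : V
  u : V → ℝ → ℝ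
  cap_pos : ∀ e, 0 < cap e
  cap_rat : ∀ e, ∃ q : ℚ, cap e = (q : ℝ)
  time_pos : ∀ e, 0 < time e
  time_rat : ∀ e, ∃ q : ℚ, time e = (q : ℝ)
  reach : ∀ v, ∃ L : List E, IsWalk tail head v sink L
  u_nonneg : ∀ v θ, 0 ≤ u v θ
  u_rat : ∀ v θ, ∃ q : ℚ, u v θ = (q : ℝ)
  u_sink : ∀ θ, u sink θ = 0
  u_neg : ∀ v θ, θ < 0 → u v θ = 0
  u_step : ∀ v, RightConstantStep (u v)

variable {V E : Type} [Fintype V] [DecidableEq V] [Fintype E] [DecidableEq E]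

/-- The edges leaving a node `v`, i.e. `δ⁺(v)`. -/
def Network.outEdges (N : Network V E) (v : V) : Finset E :=
  Finset.univ.filter (fun e => N.tail e = v)

/-- The edges entering a node `v`, i.e. `δ⁻(v)`. -/
def Network.inEdges (N : Network V E) (v : V) : Finset E :=
  Finset.univ.filter (fun e => N.head e = v)

/-- `τ_min`, the minimal travel time of an edge. -/
noncomputable def Network.tauMin (N : Network V E) : ℝ := sInf (Set.range N.time)

/-- `max_ζ u_v(ζ)`, the maximal network inflow rate at `v`. -/
noncomputable def Network.uMax (N : Network V E) (v : V) : ℝ := ⨆ θ : ℝ, N.u v θ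

/-- The maximal out-degree `Δ` of the network. -/
def Network.maxOutDeg (N : Network V E) : ℕ :=
  Finset.univ.sup (fun v => (N.outEdges v).card)

/-- All network inflow rates have bounded support. -/
def Network.BddInflow (N : Network V E) : Prop :=
  ∀ v, ∃ B : ℝ, ∀ θ, B ≤ θ → N.u v θ = 0

/-- The directed graph of the network is acyclic. -/
def Network.Acyclic (N : Network V E) : Prop :=
  ∀ (v : V) (L : List E), L ≠ [] → ¬ IsWalk N.tail N.head v v L

/-- A flow over time: locally integrable nonnegative edge in- and outflow rates. -/
structure FlowOverTime (N : Network V E) where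
  fplus : E → ℝ → ℝ
  fminus : E → ℝ → ℝ
  fplus_nonneg : ∀ e θ, 0 ≤ fplus e θ
  fminus_nonneg : ∀ e θ, 0 ≤ fminus e θ
  fplus_int : ∀ e θ, IntervalIntegrable (fplus e) volume 0 θ
  fminus_int : ∀ e θ, IntervalIntegrable (fminus e) volume 0 θ

/-- The queue length `q_e(θ) = F⁺_e(θ) − F⁻_e(θ + τ_e)`. -/
noncomputable def queueOf (N : Network V E) (fplus fminus : E → ℝ → ℝ) (e : E) (θ : ℝ) : ℝ :=
  (∫ ζ in (0:ℝ)..θ, fplus e ζ) - ∫ ζ in (0:ℝ)..(θ + N.time e), fminus e ζ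

/-- The instantaneous travel time `c_e(θ) = τ_e + q_e(θ)/ν_e`. -/
noncomputable def ctimeOf (N : Network V E) (fplus fminus : E → ℝ → ℝ) (e : E) (θ : ℝ) : ℝ :=
  N.time e + queueOf N fplus fminus e θ / N.cap e

/-- The node label `ℓ_v(θ)`: the shortest instantaneous travel time from `v` to the sink. -/
noncomputable def labelOf (N : Network V E) (fplus fminus : E → ℝ → ℝ) (v : V) (θ : ℝ) : ℝ :=
  sInf { r : ℝ | ∃ L : List E, IsWalk N.tail N.head v N.sink L ∧
                  r = (L.map (fun e => ctimeOf N fplus fminus e θ)).sum }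

/-- Edge `e` is active at time `θ`: `ℓ_{tail e}(θ) = c_e(θ) + ℓ_{head e}(θ)`. -/
def ActiveOf (N : Network V E) (fplus fminus : E → ℝ → ℝ) (e : E) (θ : ℝ) : Prop :=
  labelOf N fplus fminus (N.tail e) θ =
    ctimeOf N fplus fminus e θ + labelOf N fplus fminus (N.head e) θ

/-- Feasibility of a flow over time: flow conservation (i)/(ii), no outflow before `τ_e`
(iii), and queues operating at capacity (iv). -/
def Feasible (N : Network V E) (f : FlowOverTime N) : Prop :=
  (∀ v, v ≠ N.sink → ∀ θ : ℝ, 0 ≤ θ →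
      (∑ e ∈ N.outEdges v, f.fplus e θ) - (∑ e ∈ N.inEdges v, f.fminus e θ) = N.u v θ) ∧
  (∀ θ : ℝ, 0 ≤ θ →
      (∑ e ∈ N.outEdges N.sink, f.fplus e θ) - (∑ e ∈ N.inEdges N.sink, f.fminus e θ) ≤ 0) ∧
  (∀ e, ∀ θ : ℝ, 0 ≤ θ → θ < N.time e → f.fminus e θ = 0) ∧
  (∀ e, ∀ θ : ℝ, 0 ≤ θ →
      f.fminus e (θ + N.time e) =
        if 0 < queueOf N f.fplus f.fminus e θ then N.cap e
        else min (f.fplus e θ) (N.cap e))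

/-- An instantaneous dynamic equilibrium: a feasible flow that only sends flow
into currently active edges. -/
def IsIDE (N : Network V E) (f : FlowOverTime N) : Prop :=
  Feasible N f ∧
  ∀ e, ∀ θ : ℝ, 0 ≤ θ → 0 < f.fplus e θ → ActiveOf N f.fplus f.fminus e θ

/-- `g` is almost everywhere constant on the set `S`. -/
def AEConstOn (g : ℝ → ℝ) (S : Set ℝ) : Prop :=
  ∃ c : ℝ, ∀ᵐ θ ∂(volume.restrict S), g θ = c

/-- The `i`-th segment of the partition `0 = t 0 < t 1 < ⋯ < t n < ∞`. -/
def phaseSeg (n : ℕ) (t : ℕ → ℝ) (i : ℕ) : Set ℝ :=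
  if i < n then Set.Ioo (t i) (t (i+1)) else Set.Ioi (t n)

/-- `ℝ≥0` splits (up to finitely many points) into the `n+1` intervals given by
`t`, on each of which all edge in- and outflow rates are a.e. constant; i.e. the
flow has at most `n+1` phases. -/
def PhasePartition (N : Network V E) (f : FlowOverTime N) (n : ℕ) (t : ℕ → ℝ) : Prop :=
  t 0 = 0 ∧ (∀ i, i < n → t i < t (i+1)) ∧
  ∀ i, i ≤ n → ∀ e, AEConstOn (f.fplus e) (phaseSeg n t i) ∧ AEConstOn (f.fminus e) (phaseSeg n t i)

/-- A node potential solving the Bellman equations for the edge costs `c`; for positive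
costs it is the shortest-path distance to the sink. -/
structure IsPotential (N : Network V E) (c : E → ℝ) (π : V → ℝ) : Prop where
  sink : π N.sink = 0
  le : ∀ e, π (N.tail e) ≤ c e + π (N.head e)
  tight : ∀ v, v ≠ N.sink → ∃ e, N.tail e = v ∧ π v = c e + π (N.head e)

lemma IsPotential.le_walk {N : Network V E} {c : E → ℝ} {π : V → ℝ} (h : IsPotential N c π) :
    ∀ (L : List E) (v : V), IsWalk N.tail N.head v N.sink L → π v ≤ (L.map c).sum
  | [], v, hw => by
      have hv : v = N.sink := hw
      simp [hv, h.sink]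
  | e :: L, v, hw => by
      obtain ⟨rfl, hw⟩ := hw
      have := h.le_walk L _ hw
      have := h.le e
      simp only [List.map_cons, List.sum_cons]
      linarith

lemma IsPotential.exists_walk {N : Network V E} {c : E → ℝ} {π : V → ℝ}
    (h : IsPotential N c π) (hc : ∀ e, 0 < c e) (v : V) :
    ∃ L, IsWalk N.tail N.head v N.sink L ∧ π v = (L.map c).sum := by
  have wf : WellFounded (fun a b : V => π a < π b) :=
    (Finite.wellFounded_of_trans_of_irrefl _ :
      WellFounded (fun a b : V => π a < π b))
  induction v using wf.induction with
  | _ v ih =>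
    by_cases hv : v = N.sink
    · exact ⟨[], hv, by simp [hv, h.sink]⟩
    · obtain ⟨e, rfl, he⟩ := h.tight v hv
      obtain ⟨L, hL, hs⟩ := ih (N.head e) (by linarith [hc e])
      exact ⟨e :: L, ⟨rfl, hL⟩, by simp [he, hs]⟩

lemma IsPotential.sInf_eq {N : Network V E} {c : E → ℝ} {π : V → ℝ}
    (h : IsPotential N c π) (hc : ∀ e, 0 < c e) (v : V) :
    sInf {r : ℝ | ∃ L : List E, IsWalk N.tail N.head v N.sink L ∧ r = (L.map c).sum} = π v := by
  refine IsLeast.csInf_eq ⟨h.exists_walk hc v, ?_⟩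
  rintro r ⟨L, hL, rfl⟩
  exact h.le_walk L v hL

lemma IsPotential.mono {N : Network V E} {c c' : E → ℝ} {π π' : V → ℝ}
    (h : IsPotential N c π) (h' : IsPotential N c' π') (hc' : ∀ e, 0 < c' e)
    (hcc : ∀ e, c e ≤ c' e) (v : V) : π v ≤ π' v := by
  obtain ⟨L, hL, hs⟩ := h'.exists_walk hc' v
  rw [hs]
  exact (h.le_walk L v hL).trans (List.sum_le_sum fun e _ => hcc e)

lemma exists_min_walk (N : Network V E) {c : E → ℝ} (hc : ∀ e, 0 < c e) (v : V) :
    ∃ L, IsWalk N.tail N.head v N.sink L ∧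
      ∀ L', IsWalk N.tail N.head v N.sink L' → (L.map c).sum ≤ (L'.map c).sum := by
  obtain ⟨L₀, hL₀⟩ := N.reach v
  obtain ⟨m, hm, hmc⟩ : ∃ m : ℝ, 0 < m ∧ ∀ e, m ≤ c e := by
    rcases isEmpty_or_nonempty E with hE | hE
    · exact ⟨1, one_pos, fun e => hE.elim e⟩
    · obtain ⟨e₀, he₀⟩ := Finite.exists_min c
      exact ⟨c e₀, hc e₀, he₀⟩
  have hlen : ∀ L : List E, m * L.length ≤ (L.map c).sum := by
    intro L
    induction L with
    | nil => simp
    | cons e L ih =>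
      simp only [List.length_cons, List.map_cons, List.sum_cons]
      push_cast
      linarith [hmc e]
  obtain ⟨K, hK⟩ := exists_nat_gt ((L₀.map c).sum / m)
  rw [div_lt_iff₀ hm] at hK
  have hfin : {L : List E | L.length ≤ K ∧ IsWalk N.tail N.head v N.sink L}.Finite :=
    (List.finite_length_le E K).subset fun L hL => hL.1
  have hL₀K : L₀.length ≤ K := by
    by_contra hcon
    have h1 : (K : ℝ) ≤ L₀.length := by exact_mod_cast (not_le.mp hcon).le
    nlinarith [hlen L₀]
  obtain ⟨L, ⟨_, hLw⟩, hmin⟩ :=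
    Set.exists_min_image _ (fun L : List E => (L.map c).sum) hfin ⟨L₀, hL₀K, hL₀⟩
  refine ⟨L, hLw, fun L' hL' => ?_⟩
  by_cases hK' : L'.length ≤ K
  · exact hmin L' ⟨hK', hL'⟩
  · have h1 : (K : ℝ) ≤ L'.length := by exact_mod_cast (not_le.mp hK').le
    have h2 := hmin L₀ ⟨hL₀K, hL₀⟩
    nlinarith [hlen L']

lemma exists_isPotential (N : Network V E) {c : E → ℝ} (hc : ∀ e, 0 < c e) :
    ∃ π, IsPotential N c π := by
  choose L hL hmin using exists_min_walk N hc
  refine ⟨fun v => ((L v).map c).sum, ?_, fun e => ?_, fun v hv => ?_⟩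
  · refine le_antisymm (by simpa using hmin N.sink [] rfl) (List.sum_nonneg ?_)
    simp only [List.mem_map]
    rintro _ ⟨e, _, rfl⟩
    exact (hc e).le
  · simpa using hmin (N.tail e) (e :: L (N.head e)) ⟨rfl, hL _⟩
  · have hw := hL v
    have hm := hmin v
    match hLv : L v with
    | [] => rw [hLv] at hw; exact absurd hw hv
    | e :: L' =>
      rw [hLv] at hw hm
      obtain ⟨he, hw⟩ := hw
      refine ⟨e, he, ?_⟩
      simp only [List.map_cons, List.sum_cons]
      have h1 := hmin _ L' hw
      have h2 := hm (e :: L (N.head e)) ⟨he, hL _⟩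
      simp only [List.map_cons, List.sum_cons] at h2
      linarith

/-- The growth rate of a queue at an edge of capacity `ν` with inflow rate `x`, where
`z` says whether the queue is empty. -/
noncomputable def queueRate (z : Prop) [Decidable z] (ν x : ℝ) : ℝ :=
  if z then max (x - ν) 0 else x - ν

lemma exists_sq_primitive {ν a : ℝ} (hν : 0 < ν) (z : Prop) [Decidable z] :
    ∃ φ : ℝ → ℝ, Continuous φ ∧
      ∀ x y, φ y ≤ φ x + (y - x) * (queueRate z ν x / ν + a) + (y - x) ^ 2 / (2 * ν) := by
  by_cases hz : z
  · refine ⟨fun x => a * x + (max (x - ν) 0) ^ 2 / (2 * ν), by fun_prop, fun x y => ?_⟩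
    simp only [queueRate, hz, if_true]
    have key : (max (y - ν) 0) ^ 2 ≤ (max (x - ν) 0) ^ 2 + 2 * (y - x) * max (x - ν) 0
        + (y - x) ^ 2 := by
      rcases max_cases (y - ν) 0 with ⟨h1, h2⟩ | ⟨h1, h2⟩ <;>
      rcases max_cases (x - ν) 0 with ⟨h3, h4⟩ | ⟨h3, h4⟩ <;> rw [h1, h3] <;> nlinarith
    have : a * x + max (x - ν) 0 ^ 2 / (2 * ν) + (y - x) * (max (x - ν) 0 / ν + a)
        + (y - x) ^ 2 / (2 * ν) = a * y + ((max (x - ν) 0) ^ 2 + 2 * (y - x) * max (x - ν) 0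
        + (y - x) ^ 2) / (2 * ν) := by
      field_simp
      ring
    rw [this]
    gcongr
  · refine ⟨fun x => (a - 1) * x + x ^ 2 / (2 * ν), by fun_prop, fun x y => le_of_eq ?_⟩
    simp only [queueRate, hz, if_false]
    field_simp
    ring

/-- Parallel-link equilibrium: an amount `b` is distributed over the links `I` such that
only links of minimal marginal cost are used. -/
lemma exists_waterfill {ι : Type*} [DecidableEq ι] (I : Finset ι) (hI : I.Nonempty)
    (ν a : ι → ℝ) (hν : ∀ i, 0 < ν i) (Z : Finset ι) {b : ℝ} (hb : 0 ≤ b) :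
    ∃ (x : ι → ℝ) (s : ℝ), (∀ i, 0 ≤ x i) ∧ ∑ i ∈ I, x i = b ∧
      (∀ i ∈ I, s ≤ queueRate (i ∈ Z) (ν i) (x i) / ν i + a i) ∧
      (∀ i ∈ I, 0 < x i → s = queueRate (i ∈ Z) (ν i) (x i) / ν i + a i) ∧
      ∃ i ∈ I, s = queueRate (i ∈ Z) (ν i) (x i) / ν i + a i := by
  choose φ hφc hφ using fun i => exists_sq_primitive (a := a i) (hν i) (i ∈ Z)
  set K : Set (ι → ℝ) := (univ.pi fun _ => Icc 0 b) ∩ {x | ∑ i ∈ I, x i = b} with hK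
  have hKc : IsCompact K := by
    refine (isCompact_univ_pi fun _ => isCompact_Icc).inter_right ?_
    exact isClosed_eq (by fun_prop) continuous_const
  have hKn : K.Nonempty := by
    obtain ⟨i₀, hi₀⟩ := hI
    refine ⟨Pi.single i₀ b, fun i _ => ?_, ?_⟩
    · rcases eq_or_ne i i₀ with rfl | h
      · simp [hb]
      · simp [h, hb]
    · simp [hi₀]
  obtain ⟨x, hxK, hmin⟩ := hKc.exists_isMinOn hKn
    (f := fun x => ∑ i ∈ I, φ i (x i)) (by fun_prop)
  set g : ι → ℝ := fun i => queueRate (i ∈ Z) (ν i) (x i) / ν i + a i with hg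
  have hx0 : ∀ i, 0 ≤ x i := fun i => (hxK.1 i (mem_univ i)).1
  have hxs : ∑ i ∈ I, x i = b := hxK.2
  have key : ∀ i ∈ I, ∀ j ∈ I, 0 < x i → g i ≤ g j := by
    intro i hi j hj hxi
    by_contra! hlt
    have hij : i ≠ j := by rintro rfl; exact lt_irrefl _ hlt
    set C := 1 / (2 * ν i) + 1 / (2 * ν j) with hC
    have hC0 : 0 < C := by have := hν i; have := hν j; positivity
    set ε := min (x i) ((g i - g j) / (2 * C)) with hε
    have hε0 : 0 < ε := lt_min hxi (div_pos (by linarith) (by positivity))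
    have hε1 : ε ≤ x i := min_le_left _ _
    have hε2 : ε * C < g i - g j := by
      have : ε ≤ (g i - g j) / (2 * C) := min_le_right _ _
      rw [le_div_iff₀ (by positivity)] at this
      linarith
    set y : ι → ℝ := Function.update (Function.update x i (x i - ε)) j (x j + ε) with hy
    have hyi : y i = x i - ε := by simp [hy, hij]
    have hyj : y j = x j + ε := by simp [hy]
    have hyk : ∀ k, k ≠ i → k ≠ j → y k = x k := fun k h1 h2 => by simp [hy, h1, h2]
    have hsum : ∀ F : ι → ℝ → ℝ, ∑ k ∈ I, F k (y k) - ∑ k ∈ I, F k (x k)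
        = (F i (y i) - F i (x i)) + (F j (y j) - F j (x j)) := by
      intro F
      rw [← Finset.sum_sub_distrib, ← Finset.sum_pair (f := fun k => F k (y k) - F k (x k)) hij]
      symm
      refine Finset.sum_subset (by simp [Finset.insert_subset_iff, hi, hj]) fun k _ hk => ?_
      simp only [Finset.mem_insert, Finset.mem_singleton, not_or] at hk
      rw [hyk k hk.1 hk.2, sub_self]
    have hysum : ∑ k ∈ I, y k = b := by
      have := hsum fun _ r => r
      rw [hyi, hyj] at this
      linarith
    have hy0 : ∀ k, 0 ≤ y k := by
      intro k
      by_cases h1 : k = i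
      · rw [h1, hyi]; linarith
      by_cases h2 : k = j
      · rw [h2, hyj]; linarith [hx0 j]
      rw [hyk k h1 h2]; exact hx0 k
    have hyK : y ∈ K := by
      refine ⟨fun k _ => ⟨hy0 k, ?_⟩, hysum⟩
      by_cases hk : k ∈ I
      · rw [← hysum]
        exact Finset.single_le_sum (f := y) (fun k _ => hy0 k) hk
      · rw [hyk k (fun h => hk (h ▸ hi)) (fun h => hk (h ▸ hj))]
        exact (hxK.1 k (mem_univ k)).2
    have h1 : ∑ k ∈ I, φ k (x k) ≤ ∑ k ∈ I, φ k (y k) := hmin hyK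
    have h2 := hsum φ
    have h3 := hφ i (x i) (y i)
    have h4 := hφ j (x j) (y j)
    rw [hyi] at h2 h3
    rw [hyj] at h2 h4
    have h5 : 0 ≤ -(ε * (g i - g j)) + ε * (ε * C) := by
      have : ε * (ε * C) = (x i - ε - x i) ^ 2 / (2 * ν i) + (x j + ε - x j) ^ 2 / (2 * ν j) := by
        rw [hC]; ring
      simp only [hg]
      linarith
    nlinarith
  obtain ⟨i₀, hi₀, hg₀⟩ := I.exists_min_image g hI
  refine ⟨x, g i₀, hx0, hxs, hg₀, fun i hi hxi => ?_, i₀, hi₀, rfl⟩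
  exact le_antisymm (hg₀ i hi) (key i hi i₀ hi₀ hxi)

/-- `x` and `s` are constant edge inflow rates and node label slopes continuing an IDE
whose set of active edges is `A` and whose set of edges with empty queue is `Z`. -/
structure Routing (N : Network V E) (A Z : Finset E) (b : V → ℝ) (x : E → ℝ) (s : V → ℝ) :
    Prop where
  nonneg : ∀ e, 0 ≤ x e
  off : ∀ e, e ∉ A → x e = 0
  sink : s N.sink = 0
  conserve : ∀ v, v ≠ N.sink → ∑ e ∈ N.outEdges v, x e = b v
  slope_le : ∀ e ∈ A,
    s (N.tail e) ≤ queueRate (e ∈ Z) (N.cap e) (x e) / N.cap e + s (N.head e)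
  slope_eq : ∀ e ∈ A, 0 < x e →
    s (N.tail e) = queueRate (e ∈ Z) (N.cap e) (x e) / N.cap e + s (N.head e)
  tight : ∀ v, v ≠ N.sink → ∃ e ∈ A, N.tail e = v ∧
    s v = queueRate (e ∈ Z) (N.cap e) (x e) / N.cap e + s (N.head e)

lemma exists_routing (N : Network V E) (A Z : Finset E) (b : V → ℝ) (r : V → ℝ)
    (hb : ∀ v, 0 ≤ b v) (hr : ∀ e ∈ A, r (N.head e) < r (N.tail e))
    (hA : ∀ v, v ≠ N.sink → ∃ e ∈ A, N.tail e = v) (hsink : ∀ e ∈ A, N.tail e ≠ N.sink) :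
    ∃ x s, Routing N A Z b x s := by
  suffices H : ∀ U : Finset V, ∃ (x : E → ℝ) (s : V → ℝ), (∀ e, 0 ≤ x e) ∧
      (∀ e, e ∉ A → x e = 0) ∧ s N.sink = 0 ∧
      ∀ v ∈ U, v ≠ N.sink → ∑ e ∈ N.outEdges v, x e = b v ∧
        (∀ e ∈ A, N.tail e = v →
          s v ≤ queueRate (e ∈ Z) (N.cap e) (x e) / N.cap e + s (N.head e)) ∧
        (∀ e ∈ A, N.tail e = v → 0 < x e →
          s v = queueRate (e ∈ Z) (N.cap e) (x e) / N.cap e + s (N.head e)) ∧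
        (∃ e ∈ A, N.tail e = v ∧
          s v = queueRate (e ∈ Z) (N.cap e) (x e) / N.cap e + s (N.head e)) by
    obtain ⟨x, s, h1, h2, h3, h4⟩ := H Finset.univ
    have h4 := fun v => h4 v (Finset.mem_univ v)
    exact ⟨x, s, h1, h2, h3, fun v hv => (h4 v hv).1,
      fun e he => (h4 _ (hsink e he)).2.1 e he rfl,
      fun e he => (h4 _ (hsink e he)).2.2.1 e he rfl, fun v hv => (h4 v hv).2.2.2⟩
  intro U
  induction U using Finset.induction_on_max_value r with
  | empty => exact ⟨0, 0, by simp, by simp, rfl, by simp⟩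
  | insert v U hvU hmax ih =>
    obtain ⟨x, s, h1, h2, h3, h4⟩ := ih
    by_cases hv : v = N.sink
    · refine ⟨x, s, h1, h2, h3, fun w hw hws => ?_⟩
      rcases Finset.mem_insert.mp hw with rfl | hw
      · exact absurd hv hws
      · exact h4 w hw hws
    obtain ⟨e₀, he₀, he₀v⟩ := hA v hv
    set I := A.filter (fun e => N.tail e = v) with hI
    obtain ⟨y, σ, hy0, hyb, hle, heq, htight⟩ := exists_waterfill I
      ⟨e₀, by simp [hI, he₀, he₀v]⟩ N.cap (fun e => s (N.head e)) N.cap_pos Z (hb v)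
    set x' : E → ℝ := fun e => if N.tail e = v then (if e ∈ A then y e else 0) else x e with hx'
    set s' : V → ℝ := Function.update s v σ with hs'
    have hs'ne : ∀ w, w ≠ v → s' w = s w := fun w hw => by simp [hs', hw]
    have hs'v : s' v = σ := by simp [hs']
    refine ⟨x', s', fun e => ?_, fun e he => ?_, ?_, fun w hw hws => ?_⟩
    · simp only [hx']; split_ifs <;> first | exact hy0 e | exact h1 e | exact le_rfl
    · simp only [hx']; split_ifs; exacts [rfl, h2 e he]
    · rw [hs'ne _ (Ne.symm hv), h3]
    rcases eq_or_ne w v with rfl | hwv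
    · have hh : ∀ e ∈ A, N.tail e = w → s' (N.head e) = s (N.head e) ∧ x' e = y e ∧ e ∈ I := by
        intro e he hev
        refine ⟨hs'ne _ ?_, by simp [hx', hev, he], by simp [hI, he, hev]⟩
        rintro h
        have := hr e he
        rw [h, hev] at this
        exact lt_irrefl _ this
      refine ⟨?_, fun e he hev => ?_, fun e he hev => ?_, ?_⟩
      · rw [← hyb, hI, Finset.sum_filter, Network.outEdges, Finset.sum_filter,
          ← Finset.sum_subset (Finset.subset_univ A)]
        · refine Finset.sum_congr rfl fun e he => ?_
          simp only [hx', he, if_true]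
          split_ifs <;> rfl
        · intro e _ he
          simp +contextual [hx', he]
      · obtain ⟨ha, hb, hc⟩ := hh e he hev
        rw [hs'v, ha, hb]; exact hle e hc
      · obtain ⟨ha, hb, hc⟩ := hh e he hev
        rw [hs'v, ha, hb]; exact heq e hc
      · obtain ⟨e, heI, he⟩ := htight
        obtain ⟨heA, hev⟩ := Finset.mem_filter.mp heI
        obtain ⟨ha, hb, hc⟩ := hh e heA hev
        exact ⟨e, heA, hev, by rw [hs'v, ha, hb]; exact he⟩
    · have hwU : w ∈ U := by simpa [hwv] using hw
      have hh : ∀ e ∈ A, N.tail e = w → s' (N.head e) = s (N.head e) := by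
        intro e he hew
        refine hs'ne _ fun h => ?_
        have h5 := hr e he
        rw [h, hew] at h5
        exact absurd (hmax w hwU) (not_le.mpr h5)
      have hx : ∀ e, N.tail e = w → x' e = x e := fun e he => by simp [hx', he, hwv]
      obtain ⟨a1, a2, a3, e, heA, hew, a4⟩ := h4 w hwU hws
      rw [hs'ne w hwv]
      refine ⟨?_, fun e he hew => ?_, fun e he hew => ?_, e, heA, hew, ?_⟩
      · rw [← a1]
        exact Finset.sum_congr rfl fun e he => hx e (by simpa [Network.outEdges] using he)
      · rw [hx e hew, hh e he hew]; exact a2 e he hew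
      · rw [hx e hew, hh e he hew]; exact a3 e he hew
      · rw [hx e hew, hh e heA hew]; exact a4

/-- The maximal step of length at most `1` keeping finitely many affine quantities
nonnegative; if it is shorter than `1`, one of them becomes zero. -/
lemma exists_max_step {ι : Type*} [Finite ι] (a d : ι → ℝ) (ha : ∀ i, 0 ≤ a i)
    (hd : ∀ i, a i = 0 → 0 ≤ d i) :
    ∃ Δ : ℝ, 0 < Δ ∧ Δ ≤ 1 ∧ (∀ i, 0 ≤ a i + Δ * d i) ∧
      (Δ = 1 ∨ ∃ i, 0 < a i ∧ a i + Δ * d i = 0) := by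
  set f : Option ι → ℝ := fun o => o.elim 1 fun i => if d i < 0 then a i / (-d i) else 1 with hf
  have hpos : ∀ o, 0 < f o := by
    rintro (_ | i)
    · simp [hf]
    · simp only [hf, Option.elim]
      split_ifs with h
      · have : a i ≠ 0 := fun h0 => absurd (hd i h0) (not_le.mpr h)
        exact div_pos (lt_of_le_of_ne (ha i) this.symm) (by linarith)
      · exact one_pos
  obtain ⟨o, ho⟩ := Finite.exists_min f
  refine ⟨f o, hpos o, ho none, fun i => ?_, ?_⟩
  · have h1 : f o ≤ if d i < 0 then a i / (-d i) else 1 := ho (some i)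
    split_ifs at h1 with h
    · rw [le_div_iff₀ (by linarith)] at h1
      linarith
    · have := mul_nonneg (hpos o).le (not_lt.mp h)
      linarith [ha i]
  · rcases o with _ | i
    · left; rfl
    · by_cases h : d i < 0
      · right
        refine ⟨i, ?_, ?_⟩
        · exact lt_of_le_of_ne (ha i) fun h0 => absurd (hd i h0.symm) (not_le.mpr h)
        · simp only [hf, Option.elim, if_pos h]
          field_simp [h.ne]
          ring
      · left; simp [hf, h]

lemma exists_frequently_min {s : ℕ → ℝ} (hs : (range s).Finite) :
    ∃ c, (∃ᶠ n in Filter.atTop, s n = c) ∧ ∀ᶠ n in Filter.atTop, c ≤ s n := by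
  set F : Set ℝ := {c ∈ range s | ∃ᶠ n in Filter.atTop, s n = c} with hF
  have hev : ∀ᶠ n in Filter.atTop, s n ∈ F := by
    have h1 : ∀ c ∈ range s \ F, ∀ᶠ n in Filter.atTop, s n ≠ c := by
      rintro c ⟨hc, hcF⟩
      by_contra hcon
      exact hcF ⟨hc, fun h => hcon h⟩
    filter_upwards [(Filter.eventually_all_finite (hs.subset sdiff_subset)).mpr h1] with n hn
    by_contra hcon
    exact hn (s n) ⟨mem_range_self n, hcon⟩ rfl
  obtain ⟨n, hn⟩ := hev.exists
  obtain ⟨c, hc, hmin⟩ := Set.exists_min_image F id (hs.subset fun c hc => hc.1) ⟨_, hn⟩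
  exact ⟨c, hc.2, hev.mono fun n hn => hmin _ hn⟩

lemma eventually_const_of_antitone {ι : Type*} {f : ℕ → Finset ι} {M : ℕ}
    (hf : ∀ n, M ≤ n → f (n + 1) ⊆ f n) : ∃ K, M ≤ K ∧ ∀ n, K ≤ n → f n = f K := by
  have hanti : ∀ n m, M ≤ n → n ≤ m → f m ⊆ f n := by
    intro n m hn hnm
    induction m, hnm using Nat.le_induction with
    | base => exact subset_rfl
    | succ m hm ih => exact (hf m (hn.trans hm)).trans ih
  obtain ⟨K, hK, hmin⟩ : ∃ K, M ≤ K ∧ ∀ n, M ≤ n → (f K).card ≤ (f n).card := by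
    have hwf := WellFounded.has_min (r := fun a b : ℕ => a < b) Nat.lt_wfRel.wf
      ((fun n => (f n).card) '' Set.Ici M) ⟨_, M, mem_Ici.mpr le_rfl, rfl⟩
    obtain ⟨_, ⟨K, hK, rfl⟩, hmin⟩ := hwf
    exact ⟨K, hK, fun n hn => not_lt.mp (hmin _ ⟨n, hn, rfl⟩)⟩
  exact ⟨K, hK, fun n hn =>
    Finset.eq_of_subset_of_card_le (hanti K n hK hn) (hmin n (hK.trans hn))⟩

/-- A sequence of phases of a parallel-link equilibrium with fixed affine link offsets and
fixed inflow `b` changes the slope `s`, activates a link or depletes a queue only finitely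
often. `A n` and `Z n` are the active links and the empty queues in phase `n`. -/
lemma parallel_links_stabilize {ι : Type*} [DecidableEq ι] (I : Finset ι) (ν α : ι → ℝ)
    (hν : ∀ i, 0 < ν i) (A Z : ℕ → Finset ι) (q x : ℕ → ι → ℝ) (s Δ : ℕ → ℝ) (b : ℝ) (M : ℕ)
    (hs : (range s).Finite) (hΔ : ∀ n, 0 < Δ n)
    (hq : ∀ n i, 0 ≤ q n i) (hZ : ∀ n i, i ∈ Z n ↔ q n i = 0)
    (hx : ∀ n i, 0 ≤ x n i)
    (hoff : ∀ n i, i ∉ A n → x n i = 0)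
    (hsum : ∀ n, M ≤ n → ∑ i ∈ I, x n i = b)
    (hle : ∀ n, M ≤ n → ∀ i ∈ I, i ∈ A n →
      s n ≤ queueRate (i ∈ Z n) (ν i) (x n i) / ν i + α i)
    (heq : ∀ n, M ≤ n → ∀ i ∈ I, i ∈ A n → 0 < x n i →
      s n = queueRate (i ∈ Z n) (ν i) (x n i) / ν i + α i)
    (htight : ∀ n, M ≤ n → ∃ i ∈ I, i ∈ A n ∧
      s n = queueRate (i ∈ Z n) (ν i) (x n i) / ν i + α i)
    (hstay : ∀ n, M ≤ n → ∀ i ∈ I, i ∈ A n →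
      s n = queueRate (i ∈ Z n) (ν i) (x n i) / ν i + α i → i ∈ A (n + 1))
    (hjoin : ∀ n, M ≤ n → ∀ i ∈ I, i ∉ A n → i ∈ A (n + 1) →
      queueRate (i ∈ Z n) (ν i) (x n i) / ν i + α i < s n)
    (hstep : ∀ n i, q (n + 1) i = q n i + Δ n * queueRate (i ∈ Z n) (ν i) (x n i)) :
    ∃ K, M ≤ K ∧ ∀ n, K ≤ n → s n = s K ∧
      ∀ i ∈ I, (i ∈ A (n + 1) → i ∈ A n) ∧ (i ∈ Z (n + 1) → i ∈ Z n) := by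
  classical
  set thr : ℕ → ι → ℝ := fun n i => if i ∈ Z n then α i else α i - 1 with hthr
  obtain ⟨c, hfreq, hev⟩ := exists_frequently_min hs
  obtain ⟨M₁, hM₁⟩ := Filter.eventually_atTop.mp hev
  -- rates at zero inflow
  have hrate0 : ∀ n i, x n i = 0 → queueRate (i ∈ Z n) (ν i) (x n i) / ν i + α i = thr n i := by
    intro n i h0
    have := hν i
    simp only [hthr, queueRate, h0]
    split_ifs
    · rw [max_eq_right (by linarith)]; simp
    · field_simp; ring
  have hrateeq : ∀ n, M ≤ n → ∀ i ∈ I, i ∈ A n → thr n i ≤ s n →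
      s n = queueRate (i ∈ Z n) (ν i) (x n i) / ν i + α i := by
    intro n hn i hi hA ht
    rcases (hx n i).eq_or_lt with h0 | h0
    · have h1 := hle n hn i hi hA
      rw [hrate0 n i h0.symm] at h1 ⊢
      linarith
    · exact heq n hn i hi hA h0
  have hlow : ∀ n i, thr n i ≤ queueRate (i ∈ Z n) (ν i) (x n i) / ν i + α i := by
    intro n i
    have := hν i
    simp only [hthr, queueRate]
    split_ifs
    · have : 0 ≤ max (x n i - ν i) 0 / ν i := div_nonneg (le_max_right _ _) this.le
      linarith
    · rw [sub_div, div_self this.ne']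
      have : 0 ≤ x n i / ν i := div_nonneg (hx n i) this.le
      linarith
  -- inflow as a function of the slope
  have hflow : ∀ n i, s n = queueRate (i ∈ Z n) (ν i) (x n i) / ν i + α i →
      x n i ≤ ν i * (s n - α i + 1) := by
    intro n i h
    have h2 := hν i
    have h3 : ν i * (s n - α i + 1) = queueRate (i ∈ Z n) (ν i) (x n i) + ν i := by
      rw [h]; field_simp; ring
    rw [h3, queueRate]
    split_ifs
    · linarith [le_max_left (x n i - ν i) 0]
    · linarith
  have hflow' : ∀ n i, s n = queueRate (i ∈ Z n) (ν i) (x n i) / ν i + α i → thr n i < s n →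
      x n i = ν i * (s n - α i + 1) := by
    intro n i h ht
    have h2 := hν i
    have h3 : ν i * (s n - α i + 1) = queueRate (i ∈ Z n) (ν i) (x n i) + ν i := by
      rw [h]; field_simp; ring
    rw [h3]
    simp only [hthr] at ht
    simp only [queueRate] at h ⊢
    split_ifs at h ht ⊢
    · have h4 : 0 < max (x n i - ν i) 0 := by
        by_contra hcon
        have : max (x n i - ν i) 0 / ν i ≤ 0 :=
          div_nonpos_of_nonpos_of_nonneg (not_lt.mp hcon) h2.le
        linarith
      rcases lt_max_iff.mp h4 with h5 | h5
      · rw [max_eq_left h5.le]; ring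
      · exact absurd h5 (lt_irrefl _)
    · ring
  -- a queue starting to build up belongs to a link that stays active
  have hbuild : ∀ n, M ≤ n → ∀ i ∈ I, i ∈ Z n → i ∉ Z (n + 1) →
      i ∈ A n ∧ α i < s n ∧ s n = queueRate (i ∈ Z n) (ν i) (x n i) / ν i + α i := by
    intro n hn i hi h1 h2
    have h3 := hstep n i
    rw [(hZ n i).mp h1, zero_add] at h3
    have h4 : 0 < queueRate (i ∈ Z n) (ν i) (x n i) := by
      have h5 : 0 < q (n + 1) i :=
        lt_of_le_of_ne (hq _ _) fun h => h2 ((hZ _ _).mpr h.symm)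
      rw [h3] at h5
      exact (mul_pos_iff_of_pos_left (hΔ n)).mp h5
    have hx0 : 0 < x n i := by
      simp only [queueRate, h1, if_true] at h4
      rcases lt_max_iff.mp h4 with h5 | h5
      · linarith [hν i]
      · exact absurd h5 (lt_irrefl _)
    have hA : i ∈ A n := by
      by_contra hA
      rw [hoff n i hA] at hx0
      exact lt_irrefl _ hx0
    have h6 := heq n hn i hi hA hx0
    exact ⟨hA, by linarith [div_pos h4 (hν i)], h6⟩
  set B : ℕ → Finset ι := fun n => I.filter fun i => i ∉ A n ∧ thr n i ≤ c with hB
  have hthr_succ : ∀ n i, i ∈ Z n ∨ i ∉ Z (n + 1) → thr (n + 1) i ≤ thr n i := by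
    intro n i h
    simp only [hthr]
    split_ifs <;> first | linarith | tauto
  have hthr_mono : ∀ n, M ≤ n → ∀ i ∈ I, ¬ thr n i ≤ c → thr (n + 1) i ≤ c →
      i ∈ A n ∧ α i < s n ∧ s n = queueRate (i ∈ Z n) (ν i) (x n i) / ν i + α i := by
    intro n hn i hi h1 h2
    simp only [hthr] at h1 h2
    refine hbuild n hn i hi ?_ ?_
    · by_contra h; simp only [h, if_false] at h1; split_ifs at h2 <;> linarith
    · intro h; simp only [h, if_true] at h2; split_ifs at h1 <;> linarith
  have hBanti : ∀ n, max M M₁ ≤ n → B (n + 1) ⊆ B n := by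
    intro n hn i hi
    have hnM := (le_max_left _ _).trans hn
    have hc := hM₁ n ((le_max_right _ _).trans hn)
    simp only [hB, Finset.mem_filter] at hi ⊢
    obtain ⟨hiI, hA1, ht1⟩ := hi
    by_contra hcon
    apply hA1
    by_cases ht : thr n i ≤ c
    · have hA : i ∈ A n := by by_contra hA; exact hcon ⟨hiI, hA, ht⟩
      exact hstay n hnM i hiI hA (hrateeq n hnM i hiI hA (ht.trans hc))
    · obtain ⟨hA, _, h⟩ := hthr_mono n hnM i hiI ht ht1
      exact hstay n hnM i hiI hA h
  obtain ⟨M₂, hM₂, hBc⟩ := eventually_const_of_antitone hBanti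
  have hBeq : ∀ n, M₂ ≤ n → B n = B (n + 1) := fun n hn => by
    rw [hBc n hn, hBc (n + 1) (hn.trans n.le_succ)]
  have hMM : M ≤ M₂ := (le_max_left _ _).trans hM₂
  -- the slope cannot drop to its minimal value any more
  have hnodrop : ∀ n, M₂ ≤ n → s (n + 1) = c → s n = c := by
    intro n hn hsc
    have hnM := hMM.trans hn
    have hnM' : M ≤ n + 1 := hnM.trans n.le_succ
    by_contra hne
    have hgt : c < s n :=
      lt_of_le_of_ne (hM₁ n ((le_max_right _ _).trans (hM₂.trans hn))) (Ne.symm hne)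
    have key : ∀ i ∈ I, i ∈ A (n + 1) → thr (n + 1) i ≤ c →
        x n i = ν i * (s n - α i + 1) := by
      intro i hi hA ht
      by_cases ht0 : thr n i ≤ c
      · have hA0 : i ∈ A n := by
          by_contra hA0
          have : i ∈ B n := Finset.mem_filter.mpr ⟨hi, hA0, ht0⟩
          rw [hBeq n hn] at this
          exact (Finset.mem_filter.mp this).2.1 hA
        exact hflow' n i (hrateeq n hnM i hi hA0 (ht0.trans hgt.le)) (ht0.trans_lt hgt)
      · obtain ⟨_, h1, h2⟩ := hthr_mono n hnM i hi ht0 ht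
        refine hflow' n i h2 (lt_of_le_of_lt ?_ h1)
        simp only [hthr]; split_ifs <;> linarith
    have hlt : ∀ i ∈ I, i ∈ A (n + 1) →
        s (n + 1) = queueRate (i ∈ Z (n + 1)) (ν i) (x (n + 1) i) / ν i + α i →
        x (n + 1) i < x n i := by
      intro i hi hA h
      have ht := hlow (n + 1) i
      rw [← h, hsc] at ht
      rw [key i hi hA ht]
      have h1 := hflow (n + 1) i h
      rw [hsc] at h1
      nlinarith [hν i]
    have : ∑ i ∈ I, x (n + 1) i < ∑ i ∈ I, x n i := by
      refine Finset.sum_lt_sum (fun i hi => ?_) ?_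
      · rcases (hx (n + 1) i).eq_or_lt with h0 | h0
        · rw [← h0]; exact hx n i
        · have hA : i ∈ A (n + 1) := by
            by_contra hA
            rw [hoff _ i hA] at h0
            exact lt_irrefl _ h0
          exact (hlt i hi hA (heq _ hnM' i hi hA h0)).le
      · obtain ⟨i, hi, hA, h⟩ := htight (n + 1) hnM'
        exact ⟨i, hi, hlt i hi hA h⟩
    rw [hsum n hnM, hsum (n + 1) hnM'] at this
    exact lt_irrefl _ this
  have hconst : ∀ n, M₂ ≤ n → s n = c := by
    intro n hn
    obtain ⟨m, hm, hmc⟩ := (Filter.frequently_atTop.mp hfreq) n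
    induction m, hm using Nat.le_induction with
    | base => exact hmc
    | succ m hm ih => exact ih (hnodrop m (hn.trans hm) hmc)
  set R : ℕ → Finset ι := fun n => I.filter fun i => i ∉ Z n ∧ ¬ (i ∈ A n ∧ α i < c) with hR
  have hRdep : ∀ n, M₂ ≤ n → ∀ i ∈ I, i ∈ A n → α i < c →
      i ∈ A (n + 1) ∧ i ∉ Z (n + 1) := by
    intro n hn i hi hA ha
    have hnM := hMM.trans hn
    have hthrc : thr n i < s n := by
      rw [hconst n hn]
      simp only [hthr]; split_ifs <;> linarith
    have h1 := hrateeq n hnM i hi hA hthrc.le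
    refine ⟨hstay n hnM i hi hA h1, fun hz => ?_⟩
    have h2 := (hZ _ _).mp hz
    rw [hstep n i] at h2
    have h3 : 0 < queueRate (i ∈ Z n) (ν i) (x n i) := by
      by_contra hcon
      have := div_nonpos_of_nonpos_of_nonneg (not_lt.mp hcon) (hν i).le
      rw [hconst n hn] at h1
      linarith
    linarith [hq n i, mul_pos (hΔ n) h3]
  have hRanti : ∀ n, M₂ ≤ n → R (n + 1) ⊆ R n := by
    intro n hn i hi
    simp only [hR, Finset.mem_filter] at hi ⊢
    obtain ⟨hiI, hZ1, h1⟩ := hi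
    refine ⟨hiI, fun hz => ?_, fun h => ?_⟩
    · obtain ⟨hA, h2, _⟩ := hbuild n (hMM.trans hn) i hiI hz hZ1
      rw [hconst n hn] at h2
      exact h1 ⟨(hRdep n hn i hiI hA h2).1, h2⟩
    · exact h1 ⟨(hRdep n hn i hiI h.1 h.2).1, h.2⟩
  obtain ⟨K, hK, hRc⟩ := eventually_const_of_antitone hRanti
  refine ⟨K, hMM.trans hK, fun n hn => ⟨by rw [hconst n (hK.trans hn), hconst K hK],
    fun i hi => ⟨fun hA1 => ?_, fun hz1 => ?_⟩⟩⟩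
  · by_contra hA
    have hnM := hMM.trans (hK.trans hn)
    have h1 := hjoin n hnM i hi hA hA1
    rw [hrate0 n i (hoff n i hA), hconst n (hK.trans hn)] at h1
    have h2 : i ∈ B n := Finset.mem_filter.mpr ⟨hi, hA, h1.le⟩
    rw [hBeq n (hK.trans hn)] at h2
    exact (Finset.mem_filter.mp h2).2.1 hA1
  · by_contra hz
    have h2 : i ∈ R n := Finset.mem_filter.mpr
      ⟨hi, hz, fun h => (hRdep n (hK.trans hn) i hi h.1 h.2).2 hz1⟩
    rw [hRc n hn, ← hRc (n + 1) (hn.trans n.le_succ)] at h2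
    exact (Finset.mem_filter.mp h2).2.1 hz1

lemma queueRate_le {z : Prop} [Decidable z] {ν x : ℝ} (hν : 0 < ν) (hx : 0 ≤ x) :
    queueRate z ν x ≤ x := by
  unfold queueRate
  split_ifs
  · exact max_le (by linarith) hx
  · linarith

/-- The instantaneous travel times for queue lengths `q`. -/
noncomputable def edgeCost (N : Network V E) (q : E → ℝ) (e : E) : ℝ :=
  N.time e + q e / N.cap e

lemma edgeCost_pos (N : Network V E) {q : E → ℝ} (hq : ∀ e, 0 ≤ q e) (e : E) :
    0 < edgeCost N q e :=
  add_pos_of_pos_of_nonneg (N.time_pos e) (div_nonneg (hq e) (N.cap_pos e).le)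

open Classical in
/-- The active edges for queue lengths `q` and node labels `l`. -/
noncomputable def activeEdges (N : Network V E) (q : E → ℝ) (l : V → ℝ) : Finset E :=
  Finset.univ.filter fun e => l (N.tail e) = edgeCost N q e + l (N.head e)

open Classical in
/-- The edges without queue. -/
noncomputable def emptyQueues (q : E → ℝ) : Finset E := Finset.univ.filter fun e => q e = 0

lemma mem_activeEdges {N : Network V E} {q : E → ℝ} {l : V → ℝ} {e : E} :
    e ∈ activeEdges N q l ↔ l (N.tail e) = edgeCost N q e + l (N.head e) := by
  simp [activeEdges]

lemma mem_emptyQueues {E : Type} [Fintype E] {q : E → ℝ} {e : E} : e ∈ emptyQueues q ↔ q e = 0 := by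
  simp [emptyQueues]

lemma IsPotential.nonneg {N : Network V E} {c : E → ℝ} {π : V → ℝ}
    (h : IsPotential N c π) (hc : ∀ e, 0 < c e) (v : V) : 0 ≤ π v := by
  obtain ⟨L, _, hs⟩ := h.exists_walk hc v
  rw [hs]
  refine List.sum_nonneg ?_
  simp only [List.mem_map]
  rintro _ ⟨e, _, rfl⟩
  exact (hc e).le

lemma IsPotential.tail_ne_sink {N : Network V E} {c : E → ℝ} {π : V → ℝ}
    (h : IsPotential N c π) (hc : ∀ e, 0 < c e) {e : E}
    (he : π (N.tail e) = c e + π (N.head e)) : N.tail e ≠ N.sink := by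
  intro hs
  rw [hs, h.sink] at he
  linarith [hc e, h.nonneg hc (N.head e)]

lemma exists_routing_of_isPotential {N : Network V E} {q : E → ℝ} {l : V → ℝ} {b : V → ℝ}
    (hq : ∀ e, 0 ≤ q e) (hl : IsPotential N (edgeCost N q) l) (hb : ∀ v, 0 ≤ b v) :
    ∃ x s, Routing N (activeEdges N q l) (emptyQueues q) b x s := by
  refine exists_routing N _ _ b l hb (fun e he => ?_) (fun v hv => ?_) (fun e he => ?_)
  · rw [mem_activeEdges] at he
    linarith [edgeCost_pos N hq e]
  · obtain ⟨e, rfl, he⟩ := hl.tight v hv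
    exact ⟨e, mem_activeEdges.mpr he, rfl⟩
  · exact hl.tail_ne_sink (edgeCost_pos N hq) (mem_activeEdges.mp he)

/-- The growth rates of the queues for inflow rates `x`. -/
noncomputable def queueRates (N : Network V E) (q x : E → ℝ) (e : E) : ℝ :=
  queueRate (e ∈ emptyQueues q) (N.cap e) (x e)

/-- A routing can be continued with constant rates until an edge becomes active, a queue
becomes empty, one of the times in `P` is reached, or one unit of time has passed. -/
lemma exists_phase_length {N : Network V E} {q : E → ℝ} {l : V → ℝ} {b : V → ℝ}
    (hq : ∀ e, 0 ≤ q e) (hl : IsPotential N (edgeCost N q) l) {x : E → ℝ} {s : V → ℝ}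
    (h : Routing N (activeEdges N q l) (emptyQueues q) b x s) (t : ℝ) (P : Finset ℝ) :
    ∃ Δ : ℝ, 0 < Δ ∧ Δ ≤ 1 ∧ (∀ e, 0 ≤ q e + Δ * queueRates N q x e) ∧
      IsPotential N (edgeCost N fun e => q e + Δ * queueRates N q x e)
        (fun v => l v + Δ * s v) ∧
      (∀ p ∈ P, t < p → t + Δ ≤ p) ∧
      (Δ = 1 ∨
        (∃ e, e ∉ activeEdges N q l ∧ e ∈ activeEdges N
          (fun e => q e + Δ * queueRates N q x e) fun v => l v + Δ * s v) ∨
        (∃ e, e ∉ emptyQueues q ∧ e ∈ emptyQueues fun e => q e + Δ * queueRates N q x e) ∨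
        t + Δ ∈ P) := by
  classical
  set a : E ⊕ E ⊕ P → ℝ := Sum.elim (fun e => edgeCost N q e + l (N.head e) - l (N.tail e))
    (Sum.elim q fun p => if t < p then (p : ℝ) - t else 0) with ha
  set d : E ⊕ E ⊕ P → ℝ := Sum.elim
    (fun e => queueRates N q x e / N.cap e + s (N.head e) - s (N.tail e))
    (Sum.elim (queueRates N q x) fun p => if t < p then -1 else 0) with hd
  have hcost : ∀ Δ e, edgeCost N (fun e => q e + Δ * queueRates N q x e) e
      = edgeCost N q e + Δ * (queueRates N q x e / N.cap e) := by
    intro Δ e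
    simp only [edgeCost]; ring
  obtain ⟨Δ, h0, h1, hnn, hev⟩ := exists_max_step a d (by
    rintro (e | e | p)
    · simp only [ha, Sum.elim_inl]
      linarith [hl.le e]
    · exact hq e
    · simp only [ha, Sum.elim_inr]
      split_ifs with hp
      · linarith
      · exact le_rfl) (by
    rintro (e | e | p) h0
    · simp only [ha, hd, Sum.elim_inl] at h0 ⊢
      have := h.slope_le e (mem_activeEdges.mpr (by linarith))
      simp only [queueRates]
      linarith
    · simp only [ha, hd, Sum.elim_inl, Sum.elim_inr] at h0 ⊢
      simp [queueRates, queueRate, mem_emptyQueues, h0]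
    · simp only [ha, hd, Sum.elim_inr] at h0 ⊢
      split_ifs at h0 ⊢ with hp
      · linarith
      · exact le_rfl)
  refine ⟨Δ, h0, h1, fun e => hnn (Sum.inr (Sum.inl e)), ⟨?_, fun e => ?_, fun v hv => ?_⟩,
    fun p hp htp => ?_, ?_⟩
  · simp [hl.sink, h.sink]
  · have := hnn (Sum.inl e)
    simp only [ha, hd, Sum.elim_inl] at this
    rw [hcost]
    linarith
  · obtain ⟨e, he, rfl, hs⟩ := h.tight v hv
    refine ⟨e, rfl, ?_⟩
    rw [hcost, mem_activeEdges.mp he, hs]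
    simp only [queueRates]
    ring
  · have := hnn (Sum.inr (Sum.inr ⟨p, hp⟩))
    simp only [ha, hd, Sum.elim_inr, if_pos htp] at this
    linarith
  · rcases hev with hev | ⟨e | e | p, hp, hz⟩
    · exact Or.inl hev
    · simp only [ha, hd, Sum.elim_inl] at hp hz
      refine Or.inr (Or.inl ⟨e, fun he => ?_, mem_activeEdges.mpr ?_⟩)
      · rw [mem_activeEdges] at he; linarith
      · rw [hcost]; linarith
    · simp only [ha, hd, Sum.elim_inl, Sum.elim_inr] at hp hz
      exact Or.inr (Or.inr (Or.inl
        ⟨e, fun he => hp.ne' (mem_emptyQueues.mp he), mem_emptyQueues.mpr hz⟩))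
    · simp only [ha, hd, Sum.elim_inr] at hp hz
      split_ifs at hp hz with htp
      · refine Or.inr (Or.inr (Or.inr ?_))
        rw [show t + Δ = p by linarith]
        exact p.2
      · exact absurd hp (lt_irrefl _)

open Classical in
/-- A choice of routings depending only on the data of the routing problem. -/
noncomputable def route (N : Network V E) (A Z : Finset E) (b : V → ℝ) : (E → ℝ) × (V → ℝ) :=
  if h : ∃ p : (E → ℝ) × (V → ℝ), Routing N A Z b p.1 p.2 then h.choose else 0

lemma route_spec {N : Network V E} {A Z : Finset E} {b : V → ℝ}
    (h : ∃ x s, Routing N A Z b x s) :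
    Routing N A Z b (route N A Z b).1 (route N A Z b).2 := by
  have h' : ∃ p : (E → ℝ) × (V → ℝ), Routing N A Z b p.1 p.2 := by
    obtain ⟨x, s, h⟩ := h
    exact ⟨(x, s), h⟩
  rw [route, dif_pos h']
  exact h'.choose_spec

/-- An infinite sequence of phases of an IDE: phase `n` starts at time `t n` with queues
`q n` and labels `l n`; during it the edge inflow rates are `x n` and the label slopes are
`s n`. The rate at which flow entering `e` at time `θ` leaves it later is `Y e θ`. -/
structure PhaseSeq (N : Network V E) where
  t : ℕ → ℝ
  q : ℕ → E → ℝ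
  l : ℕ → V → ℝ
  x : ℕ → E → ℝ
  s : ℕ → V → ℝ
  Y : E → ℝ → ℝ
  J : Finset ℝ
  t_zero : t 0 = 0
  q_zero : ∀ e, q 0 e = 0
  t_lt : ∀ n, t n < t (n + 1)
  q_nonneg : ∀ n e, 0 ≤ q n e
  pot : ∀ n, IsPotential N (edgeCost N (q n)) (l n)
  routing : ∀ n, Routing N (activeEdges N (q n) (l n)) (emptyQueues (q n))
    (fun v => N.u v (t n) + ∑ e ∈ N.inEdges v, Y e (t n - N.time e)) (x n) (s n)
  route_eq : ∀ n, route N (activeEdges N (q n) (l n)) (emptyQueues (q n))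
    (fun v => N.u v (t n) + ∑ e ∈ N.inEdges v, Y e (t n - N.time e)) = (x n, s n)
  q_succ : ∀ n e, q (n + 1) e = q n e + (t (n + 1) - t n) * queueRates N (q n) (x n) e
  l_succ : ∀ n v, l (n + 1) v = l n v + (t (n + 1) - t n) * s n v
  Y_neg : ∀ e θ, θ < 0 → Y e θ = 0
  Y_eq : ∀ e n θ, t n ≤ θ → θ < t (n + 1) → Y e θ = x n e - queueRates N (q n) (x n) e
  u_const : ∀ v n θ, t n ≤ θ → θ < t (n + 1) → N.u v θ = N.u v (t n)
  break_le : ∀ n k e, k ≤ n → t n < t k + N.time e → t (n + 1) ≤ t k + N.time e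
  event : ∀ n, t (n + 1) = t n + 1 ∨
    (∃ e, e ∉ activeEdges N (q n) (l n) ∧ e ∈ activeEdges N (q (n + 1)) (l (n + 1))) ∨
    (∃ e, e ∉ emptyQueues (q n) ∧ e ∈ emptyQueues (q (n + 1))) ∨
    t (n + 1) ∈ J ∨ ∃ k ≤ n, ∃ e, t (n + 1) = t k + N.time e

lemma exists_jump_set (N : Network V E) : ∃ J : Finset ℝ, ∀ v x y, x ≤ y →
    (∀ p ∈ J, ¬ (x < p ∧ p ≤ y)) → N.u v x = N.u v y := by
  choose J hJ using N.u_step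
  exact ⟨Finset.univ.biUnion J, fun v x y hxy h => hJ v x y hxy fun p hp =>
    h p (Finset.mem_biUnion.mpr ⟨v, Finset.mem_univ v, hp⟩)⟩

/-- The state of the flow at the start of a phase, `S` being the set of times at which
the outflow rates already determined may jump. -/
structure PhaseState (V E : Type) where
  t : ℝ
  q : E → ℝ
  l : V → ℝ
  Y : E → ℝ → ℝ
  S : Finset ℝ

namespace PhaseState

/-- The inflow rate into the node `v`. -/
noncomputable def inflow (N : Network V E) (σ : PhaseState V E) (v : V) : ℝ :=
  N.u v σ.t + ∑ e ∈ N.inEdges v, σ.Y e (σ.t - N.time e)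

/-- The routing used in the phase starting in `σ`. -/
noncomputable def rates (N : Network V E) (σ : PhaseState V E) : (E → ℝ) × (V → ℝ) :=
  route N (activeEdges N σ.q σ.l) (emptyQueues σ.q) (σ.inflow N)

/-- The times at which outflow rates may jump. -/
noncomputable def jumps (N : Network V E) (σ : PhaseState V E) : Finset ℝ :=
  σ.S ∪ Finset.univ.image fun e => σ.t + N.time e

/-- The state after a phase of length `Δ`. -/
noncomputable def next (N : Network V E) (σ : PhaseState V E) (Δ : ℝ) : PhaseState V E where
  t := σ.t + Δ
  q := fun e => σ.q e + Δ * queueRates N σ.q (σ.rates N).1 e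
  l := fun v => σ.l v + Δ * (σ.rates N).2 v
  Y := fun e θ => if θ < σ.t then σ.Y e θ else
    (σ.rates N).1 e - queueRates N σ.q (σ.rates N).1 e
  S := σ.jumps N

/-- The state `σ` has nonnegative queues and outflow rates and correct labels. -/
structure Valid (N : Network V E) (σ : PhaseState V E) : Prop where
  q_nonneg : ∀ e, 0 ≤ σ.q e
  Y_nonneg : ∀ e θ, 0 ≤ σ.Y e θ
  pot : IsPotential N (edgeCost N σ.q) σ.l

lemma Valid.routing {N : Network V E} {σ : PhaseState V E} (h : σ.Valid N) :
    Routing N (activeEdges N σ.q σ.l) (emptyQueues σ.q) (σ.inflow N) (σ.rates N).1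
      (σ.rates N).2 :=
  route_spec (exists_routing_of_isPotential h.q_nonneg h.pot fun v =>
    add_nonneg (N.u_nonneg v _) (Finset.sum_nonneg fun e _ => h.Y_nonneg e _))

lemma exists_next {N : Network V E} (J : Finset ℝ) {σ : PhaseState V E} (h : σ.Valid N) :
    ∃ Δ, 0 < Δ ∧ (σ.next N Δ).Valid N ∧
      (∀ p ∈ J ∪ σ.jumps N, σ.t < p → σ.t + Δ ≤ p) ∧
      (Δ = 1 ∨
        (∃ e, e ∉ activeEdges N σ.q σ.l ∧
          e ∈ activeEdges N (σ.next N Δ).q (σ.next N Δ).l) ∨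
        (∃ e, e ∉ emptyQueues σ.q ∧ e ∈ emptyQueues (σ.next N Δ).q) ∨
        σ.t + Δ ∈ J ∪ σ.jumps N) := by
  obtain ⟨Δ, h0, _, h2, h3, h4, h5⟩ :=
    exists_phase_length h.q_nonneg h.pot h.routing σ.t (J ∪ σ.jumps N)
  refine ⟨Δ, h0, ⟨h2, fun e θ => ?_, h3⟩, h4, h5⟩
  simp only [next]
  split_ifs
  · exact h.Y_nonneg e θ
  · exact sub_nonneg.mpr (queueRate_le (N.cap_pos e) (h.routing.nonneg e))

end PhaseState

theorem exists_phaseSeq (N : Network V E) : Nonempty (PhaseSeq N) := by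
  classical
  obtain ⟨J, hJ⟩ := exists_jump_set N
  obtain ⟨l₀, hl₀⟩ := exists_isPotential N (edgeCost_pos N (q := 0) fun e => le_rfl)
  choose! Δ hΔ using fun (σ : PhaseState V E) (h : σ.Valid N) => PhaseState.exists_next J h
  let σ : ℕ → PhaseState V E := fun n =>
    Nat.rec ⟨0, 0, l₀, 0, ∅⟩ (fun _ σ => σ.next N (Δ σ)) n
  have hsucc : ∀ n, σ (n + 1) = (σ n).next N (Δ (σ n)) := fun n => rfl
  have hval : ∀ n, (σ n).Valid N := by
    intro n
    induction n with
    | zero => exact ⟨fun e => le_rfl, fun e θ => le_rfl, hl₀⟩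
    | succ n ih => rw [hsucc]; exact (hΔ _ ih).2.1
  have ht : ∀ n, (σ (n + 1)).t = (σ n).t + Δ (σ n) := fun n => rfl
  have htlt : ∀ n, (σ n).t < (σ (n + 1)).t := fun n => by
    rw [ht]; linarith [(hΔ _ (hval n)).1]
  have hmono : StrictMono fun n => (σ n).t := strictMono_nat_of_lt_succ htlt
  have hYsucc : ∀ n e θ, θ < (σ n).t → (σ (n + 1)).Y e θ = (σ n).Y e θ := by
    intro n e θ h
    simp [hsucc, PhaseState.next, h]
  have hYle : ∀ n m e θ, n ≤ m → θ < (σ n).t → (σ m).Y e θ = (σ n).Y e θ := by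
    intro n m e θ hnm h
    induction m, hnm using Nat.le_induction with
    | base => rfl
    | succ m hm ih => rw [hYsucc m e θ (h.trans_le (hmono.monotone hm)), ih]
  let Y : E → ℝ → ℝ := fun e θ =>
    if h : ∃ n, θ < (σ n).t then (σ (Nat.find h)).Y e θ else 0
  have hY : ∀ n e θ, θ < (σ n).t → Y e θ = (σ n).Y e θ := by
    intro n e θ h
    have hex : ∃ n, θ < (σ n).t := ⟨n, h⟩
    simp only [Y, dif_pos hex]
    exact (hYle _ n e θ (Nat.find_min' hex h) (Nat.find_spec hex)).symm
  have hin : ∀ n, (fun v => N.u v (σ n).t + ∑ e ∈ N.inEdges v, Y e ((σ n).t - N.time e))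
      = (σ n).inflow N := by
    intro n
    funext v
    refine congrArg _ (Finset.sum_congr rfl fun e _ => hY n e _ ?_)
    linarith [N.time_pos e]
  have hS : ∀ n k e, k < n → (σ k).t + N.time e ∈ (σ n).S := by
    intro n k e hk
    induction n with
    | zero => omega
    | succ n ih =>
      simp only [hsucc, PhaseState.next, PhaseState.jumps]
      rcases Nat.lt_succ_iff_lt_or_eq.mp hk with h | rfl
      · exact Finset.mem_union_left _ (ih h)
      · exact Finset.mem_union_right _ (Finset.mem_image_of_mem _ (Finset.mem_univ e))
  have hS' : ∀ n p, p ∈ (σ n).S → ∃ k < n, ∃ e, p = (σ k).t + N.time e := by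
    intro n p hp
    induction n with
    | zero => exact absurd hp (Finset.notMem_empty p)
    | succ n ih =>
      simp only [hsucc, PhaseState.next, PhaseState.jumps] at hp
      rcases Finset.mem_union.mp hp with h | h
      · obtain ⟨k, hk, e, he⟩ := ih h
        exact ⟨k, hk.trans n.lt_succ_self, e, he⟩
      · obtain ⟨e, _, he⟩ := Finset.mem_image.mp h
        exact ⟨n, n.lt_succ_self, e, he.symm⟩
  refine ⟨{
    t := fun n => (σ n).t
    q := fun n => (σ n).q
    l := fun n => (σ n).l
    x := fun n => ((σ n).rates N).1
    s := fun n => ((σ n).rates N).2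
    Y := Y
    J := J
    t_zero := rfl
    q_zero := fun e => rfl
    t_lt := htlt
    q_nonneg := fun n => (hval n).q_nonneg
    pot := fun n => (hval n).pot
    routing := fun n => by
      rw [hin n]; exact (hval n).routing
    route_eq := fun n => by rw [hin n]; rfl
    q_succ := fun n e => by
      simp [hsucc, PhaseState.next]
    l_succ := fun n v => by
      simp [hsucc, PhaseState.next]
    Y_neg := fun e θ h => by rw [hY 0 e θ h]; rfl
    Y_eq := fun e n θ h1 h2 => by
      rw [hY (n + 1) e θ h2]
      simp [hsucc, PhaseState.next, not_lt.mpr h1]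
    u_const := fun v n θ h1 h2 => by
      refine (hJ v _ _ h1 fun p hp h => ?_).symm
      have := (hΔ _ (hval n)).2.2.1 p (Finset.mem_union_left _ hp) h.1
      rw [ht] at h2
      linarith [h.2]
    break_le := fun n k e hk h => by
      rw [ht]
      refine (hΔ _ (hval n)).2.2.1 _ (Finset.mem_union_right _ ?_) h
      exact hS (n + 1) k e (Nat.lt_succ_of_le hk)
    event := fun n => ?_ }⟩
  rcases (hΔ _ (hval n)).2.2.2 with h | h | h | h
  · left; rw [ht, h]
  · exact Or.inr (Or.inl h)
  · exact Or.inr (Or.inr (Or.inl h))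
  · refine Or.inr (Or.inr (Or.inr ?_))
    rw [ht]
    rcases Finset.mem_union.mp h with h | h
    · exact Or.inl h
    · obtain ⟨k, hk, e, he⟩ := hS' (n + 1) _ h
      exact Or.inr ⟨k, Nat.lt_succ_iff.mp hk, e, he⟩

namespace PhaseSeq

open Filter Topology

variable {N : Network V E} (P : PhaseSeq N)

lemma t_strictMono : StrictMono P.t := strictMono_nat_of_lt_succ P.t_lt

lemma eventually_t_ne (c : ℝ) : ∀ᶠ n in atTop, P.t (n + 1) ≠ c := by
  by_cases h : ∃ m, P.t m = c
  · obtain ⟨m, rfl⟩ := h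
    filter_upwards [eventually_ge_atTop m] with n hn
    exact (P.t_strictMono (Nat.lt_succ_of_le hn)).ne'
  · push Not at h
    exact Eventually.of_forall fun n => h _

lemma slack_succ (n : ℕ) (e : E) :
    edgeCost N (P.q (n + 1)) e + P.l (n + 1) (N.head e) - P.l (n + 1) (N.tail e) =
      edgeCost N (P.q n) e + P.l n (N.head e) - P.l n (N.tail e) +
        (P.t (n + 1) - P.t n) * (queueRates N (P.q n) (P.x n) e / N.cap e
          + P.s n (N.head e) - P.s n (N.tail e)) := by
  simp only [edgeCost, P.q_succ, P.l_succ]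
  ring

lemma tail_ne_sink {n : ℕ} {e : E} (h : e ∈ activeEdges N (P.q n) (P.l n)) :
    N.tail e ≠ N.sink :=
  (P.pot n).tail_ne_sink (edgeCost_pos N (P.q_nonneg n)) (mem_activeEdges.mp h)

lemma eventually_empty_of_inactive {e : E}
    (h : ∀ᶠ n in atTop, e ∉ activeEdges N (P.q n) (P.l n)) :
    ∀ᶠ n in atTop, e ∈ emptyQueues (P.q (n + 1)) → e ∈ emptyQueues (P.q n) := by
  obtain ⟨M, hM⟩ := eventually_atTop.mp h
  by_cases hK : ∃ K, M ≤ K ∧ e ∈ emptyQueues (P.q K)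
  · obtain ⟨K, hMK, hK⟩ := hK
    filter_upwards [eventually_ge_atTop K] with n hn hn'
    clear hn'
    induction n, hn using Nat.le_induction with
    | base => exact hK
    | succ n hn ih =>
      have hx := (P.routing n).off e (hM n (hMK.trans hn))
      rw [mem_emptyQueues, P.q_succ, queueRates, queueRate, if_pos ih, hx,
        mem_emptyQueues.mp ih, zero_sub, max_eq_right (by linarith [N.cap_pos e])]
      simp
  · push Not at hK
    filter_upwards [eventually_ge_atTop M] with n hn h
    exact absurd h (hK (n + 1) (hn.trans n.le_succ))

/-- If the label order of active edges and the inflows into the nodes are eventually fixed,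
then eventually no edge becomes active and no queue becomes empty. -/
lemma eventually_no_event (hs : (range P.s).Finite) (r : V → ℝ)
    (hr : ∀ᶠ n in atTop, ∀ e ∈ activeEdges N (P.q n) (P.l n), r (N.head e) < r (N.tail e))
    (b : V → ℝ) (hb : ∀ᶠ n in atTop, ∀ v, v ≠ N.sink →
      ∑ e ∈ N.outEdges v, P.x n e = b v) :
    ∀ᶠ n in atTop, ∀ e,
      (e ∈ activeEdges N (P.q (n + 1)) (P.l (n + 1)) → e ∈ activeEdges N (P.q n) (P.l n)) ∧
      (e ∈ emptyQueues (P.q (n + 1)) → e ∈ emptyQueues (P.q n)) := by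
  classical
  suffices H : ∀ v, ∃ c, ∀ᶠ n in atTop, P.s n v = c ∧ ∀ e, N.tail e = v →
      (e ∈ activeEdges N (P.q (n + 1)) (P.l (n + 1)) → e ∈ activeEdges N (P.q n) (P.l n)) ∧
      (e ∈ emptyQueues (P.q (n + 1)) → e ∈ emptyQueues (P.q n)) by
    choose c hc using H
    filter_upwards [eventually_all.mpr hc] with n hn e
    exact (hn (N.tail e)).2 e rfl
  have wf : WellFounded (fun a b : V => r a < r b) :=
    (Finite.wellFounded_of_trans_of_irrefl _ : WellFounded (fun a b : V => r a < r b))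
  intro v
  induction v using wf.induction with
  | _ v ih =>
  have hinact : ∀ e, ¬ (N.tail e ≠ N.sink ∧ r (N.head e) < r (N.tail e)) →
      ∀ᶠ n in atTop, e ∉ activeEdges N (P.q n) (P.l n) := fun e he => by
    filter_upwards [hr] with n hn h
    exact he ⟨P.tail_ne_sink h, hn e h⟩
  by_cases hv : v = N.sink
  · refine ⟨0, ?_⟩
    have hE : ∀ e, ∀ᶠ n in atTop, N.tail e = v → e ∉ activeEdges N (P.q (n + 1)) (P.l (n + 1)) ∧
        (e ∈ emptyQueues (P.q (n + 1)) → e ∈ emptyQueues (P.q n)) := fun e => by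
      by_cases he : N.tail e = v
      · have := hinact e (fun h => h.1 (he.trans hv))
        filter_upwards [(tendsto_add_atTop_nat 1).eventually this,
          P.eventually_empty_of_inactive this] with n h1 h2 _ using ⟨h1, h2⟩
      · exact Eventually.of_forall fun n h => absurd h he
    filter_upwards [eventually_all.mpr hE] with n hn
    exact ⟨by rw [hv]; exact (P.routing n).sink,
      fun e he => ⟨fun h => absurd h (hn e he).1, (hn e he).2⟩⟩
  · set I : Finset E := Finset.univ.filter fun e => N.tail e = v ∧ r (N.head e) < r v with hI
    have hmem : ∀ {e}, e ∈ I ↔ N.tail e = v ∧ r (N.head e) < r v := by simp [hI]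
    have hα : ∀ e, ∃ a, e ∈ I → ∀ᶠ n in atTop, P.s n (N.head e) = a := fun e => by
      by_cases he : e ∈ I
      · obtain ⟨a, ha⟩ := ih _ (hmem.mp he).2
        exact ⟨a, fun _ => ha.mono fun n h => h.1⟩
      · exact ⟨0, fun h => absurd h he⟩
    choose α hα using hα
    have hα' : ∀ᶠ n in atTop, ∀ e, e ∈ I → P.s n (N.head e) = α e := by
      refine eventually_all.mpr fun e => ?_
      by_cases he : e ∈ I
      · exact (hα e he).mono fun n h _ => h
      · exact Eventually.of_forall fun n h => absurd h he
    have hI' : ∀ᶠ n in atTop, ∀ e ∈ activeEdges N (P.q n) (P.l n), N.tail e = v → e ∈ I := by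
      filter_upwards [hr] with n hn e he hev
      exact hmem.mpr ⟨hev, hev ▸ hn e he⟩
    obtain ⟨M, hM⟩ := eventually_atTop.mp ((hα'.and hI').and hb)
    obtain ⟨K, _, hK⟩ := parallel_links_stabilize I N.cap α N.cap_pos
      (fun n => activeEdges N (P.q n) (P.l n)) (fun n => emptyQueues (P.q n)) P.q P.x
      (fun n => P.s n v) (fun n => P.t (n + 1) - P.t n) (b v) M
      ((hs.image fun f => f v).subset (by
        rintro _ ⟨n, rfl⟩
        exact ⟨P.s n, ⟨n, rfl⟩, rfl⟩))
      (fun n => sub_pos.mpr (P.t_lt n)) P.q_nonneg (fun n i => mem_emptyQueues)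
      (fun n => (P.routing n).nonneg) (fun n => (P.routing n).off)
      (fun n hn => by
        rw [← (hM n hn).2 v hv]
        refine Finset.sum_subset (fun e he => ?_) (fun e he heI => ?_)
        · simp [Network.outEdges, (hmem.mp he).1]
        · refine (P.routing n).off e fun hA => heI ((hM n hn).1.2 e hA ?_)
          simpa [Network.outEdges] using he)
      (fun n hn e he hA => by
        rw [← (hM n hn).1.1 e he, ← (hmem.mp he).1]
        exact (P.routing n).slope_le e hA)
      (fun n hn e he hA hx => by
        rw [← (hM n hn).1.1 e he, ← (hmem.mp he).1]
        exact (P.routing n).slope_eq e hA hx)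
      (fun n hn => by
        obtain ⟨e, hA, hev, hs⟩ := (P.routing n).tight v hv
        have he := (hM n hn).1.2 e hA hev
        exact ⟨e, he, hA, by rw [← (hM n hn).1.1 e he]; exact hs⟩)
      (fun n hn e he hA hs => by
        rw [← (hM n hn).1.1 e he, ← (hmem.mp he).1] at hs
        have h1 := P.slack_succ n e
        rw [mem_activeEdges] at hA ⊢
        simp only [queueRates] at h1
        rw [show P.s n (N.tail e) = _ from hs] at h1
        rw [hA] at h1
        linarith)
      (fun n hn e he hA hA1 => by
        rw [← (hM n hn).1.1 e he, ← (hmem.mp he).1]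
        have h1 := P.slack_succ n e
        rw [mem_activeEdges] at hA hA1
        have h2 := lt_of_le_of_ne ((P.pot n).le e) hA
        simp only [queueRates] at h1
        by_contra hcon
        push Not at hcon
        have := mul_nonneg (sub_pos.mpr (P.t_lt n)).le (sub_nonneg.mpr hcon)
        linarith)
      P.q_succ
    refine ⟨P.s K v, ?_⟩
    have hE : ∀ e, ∀ᶠ n in atTop, N.tail e = v → e ∉ I →
        e ∉ activeEdges N (P.q (n + 1)) (P.l (n + 1)) ∧
        (e ∈ emptyQueues (P.q (n + 1)) → e ∈ emptyQueues (P.q n)) := fun e => by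
      by_cases he : N.tail e = v ∧ e ∉ I
      · have := hinact e (fun h => he.2 (hmem.mpr ⟨he.1, he.1 ▸ h.2⟩))
        filter_upwards [(tendsto_add_atTop_nat 1).eventually this,
          P.eventually_empty_of_inactive this] with n h1 h2 _ _ using ⟨h1, h2⟩
      · exact Eventually.of_forall fun n h h' => absurd ⟨h, h'⟩ he
    filter_upwards [eventually_ge_atTop K, eventually_all.mpr hE] with n hn hn'
    refine ⟨(hK n hn).1, fun e he => ?_⟩
    by_cases heI : e ∈ I
    · exact (hK n hn).2 e heI
    · exact ⟨fun h => absurd h (hn' e he heI).1, (hn' e he heI).2⟩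

/-- The phases exhaust all times. -/
lemma tendsto_t : Tendsto P.t atTop atTop := by
  classical
  refine tendsto_atTop_atTop_of_monotone' P.t_strictMono.monotone fun hbd => ?_
  set T := ⨆ n, P.t n
  have hT : Tendsto P.t atTop (𝓝 T) := tendsto_atTop_ciSup P.t_strictMono.monotone hbd
  have hlt : ∀ n, P.t n < T := fun n => (P.t_lt n).trans_le (le_ciSup hbd (n + 1))
  have hgt : ∀ c < T, ∀ᶠ n in atTop, c < P.t n := fun c hc => hT.eventually_const_lt hc
  have hY : ∀ e, ∃ y, ∀ᶠ n in atTop, P.Y e (P.t n - N.time e) = y := fun e => by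
    rcases le_or_gt (T - N.time e) 0 with h | h
    · exact ⟨0, Eventually.of_forall fun n => P.Y_neg e _ (by linarith [hlt n])⟩
    · have hex : ∃ k, T - N.time e ≤ P.t k :=
        ((hgt _ (by linarith [N.time_pos e])).mono fun n => le_of_lt).exists
      obtain ⟨m, hm⟩ : ∃ m, Nat.find hex = m + 1 := Nat.exists_eq_succ_of_ne_zero fun h0 => by
        have := Nat.find_spec hex
        rw [h0, P.t_zero] at this
        linarith
      have h1 : P.t m < T - N.time e := not_le.mp (Nat.find_min hex (by omega))
      have h2 : T - N.time e ≤ P.t (m + 1) := hm ▸ Nat.find_spec hex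
      refine ⟨_, (hgt (P.t m + N.time e) (by linarith)).mono fun n hn =>
        P.Y_eq e m _ (by linarith) (by linarith [hlt n])⟩
  choose y hy using hY
  have hu : ∃ w : V → ℝ, ∀ᶠ n in atTop, ∀ v, N.u v (P.t n) = w v := by
    obtain ⟨J, hJ⟩ := exists_jump_set N
    have : ∀ᶠ n in atTop, ∀ p ∈ J, p < T → p < P.t n := by
      refine (Finset.eventually_all J).mpr fun p _ => ?_
      by_cases hp : p < T
      · exact (hgt p hp).mono fun n h _ => h
      · exact Eventually.of_forall fun n h => absurd h hp
    obtain ⟨M, hM⟩ := eventually_atTop.mp this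
    refine ⟨fun v => N.u v (P.t M), eventually_atTop.mpr ⟨M, fun n hn v => ?_⟩⟩
    refine (hJ v _ _ (P.t_strictMono.monotone hn) fun p hp h => ?_).symm
    have := hM M le_rfl p hp (h.2.trans_lt (hlt n))
    linarith [h.1]
  obtain ⟨w, hw⟩ := hu
  set b : V → ℝ := fun v => w v + ∑ e ∈ N.inEdges v, y e
  have hb : ∀ᶠ n in atTop,
      (fun v => N.u v (P.t n) + ∑ e ∈ N.inEdges v, P.Y e (P.t n - N.time e)) = b := by
    filter_upwards [hw, eventually_all.mpr hy] with n h1 h2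
    funext v
    simp only [b, h1, h2]
  have hs : (range P.s).Finite := by
    obtain ⟨M, hM⟩ := eventually_atTop.mp hb
    refine ((finite_range fun p : Finset E × Finset E => (route N p.1 p.2 b).2).union
      ((finite_lt_nat M).image P.s)).subset ?_
    rintro _ ⟨n, rfl⟩
    rcases lt_or_ge n M with h | h
    · exact Or.inr ⟨n, h, rfl⟩
    · refine Or.inl ⟨(activeEdges N (P.q n) (P.l n), emptyQueues (P.q n)), ?_⟩
      have := P.route_eq n
      rw [hM n h] at this
      simp only [this]
  obtain ⟨C, hC0, hC⟩ : ∃ C, 0 < C ∧ ∀ n v, |P.s n v| ≤ C := by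
    obtain ⟨C, hC⟩ := (hs.image fun f => ‖f‖).bddAbove
    refine ⟨max C 1, lt_max_of_lt_right one_pos, fun n v => le_max_of_le_left ?_⟩
    exact (norm_le_pi_norm (P.s n) v).trans (hC ⟨_, ⟨n, rfl⟩, rfl⟩)
  have hl : ∀ m n v, m ≤ n → |P.l n v - P.l m v| ≤ C * (P.t n - P.t m) := by
    intro m n v hmn
    induction n, hmn using Nat.le_induction with
    | base => simp
    | succ n hn ih =>
      have h1 : |(P.t (n + 1) - P.t n) * P.s n v| ≤ C * (P.t (n + 1) - P.t n) := by
        rw [abs_mul, abs_of_pos (sub_pos.mpr (P.t_lt n)), mul_comm]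
        exact mul_le_mul_of_nonneg_right (hC n v) (sub_pos.mpr (P.t_lt n)).le
      rw [P.l_succ]
      rw [abs_le] at *
      constructor <;> linarith [h1.1, h1.2, ih.1, ih.2]
  obtain ⟨m, hm⟩ : ∃ m, ∀ e, 2 * C * (T - P.t m) < N.time e := by
    refine (eventually_all.mpr fun e => ?_).exists (f := atTop)
    filter_upwards [hgt (T - N.time e / (2 * C))
      (sub_lt_self _ (div_pos (N.time_pos e) (by linarith)))] with n hn
    rw [sub_lt_comm, lt_div_iff₀ (by linarith)] at hn
    linarith
  have hr : ∀ᶠ n in atTop, ∀ e ∈ activeEdges N (P.q n) (P.l n),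
      P.l m (N.head e) < P.l m (N.tail e) := by
    filter_upwards [eventually_ge_atTop m] with n hn e he
    rw [mem_activeEdges, edgeCost] at he
    have h1 := abs_le.mp (hl m n (N.head e) hn)
    have h2 := abs_le.mp (hl m n (N.tail e) hn)
    have h3 := div_nonneg (P.q_nonneg n e) (N.cap_pos e).le
    have h4 := mul_lt_mul_of_pos_left (hlt n) hC0
    linarith [hm e, h1.1, h1.2, h2.1, h2.2]
  have hno := P.eventually_no_event hs (P.l m) hr b <| hb.mono fun n hn v hv => by
    rw [← hn]; exact (P.routing n).conserve v hv
  have hone : ∀ᶠ n in atTop, P.t (n + 1) ≠ P.t n + 1 := by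
    filter_upwards [hgt (T - 1) (by linarith)] with n hn
    linarith [hlt (n + 1)]
  have hJ : ∀ᶠ n in atTop, P.t (n + 1) ∉ P.J := by
    have := (Finset.eventually_all P.J).mpr fun p (_ : p ∈ P.J) => P.eventually_t_ne p
    filter_upwards [this] with n hn h
    exact hn _ h rfl
  have hbr : ∀ e, ∀ᶠ n in atTop, ∀ k, P.t (n + 1) ≠ P.t k + N.time e := fun e => by
    obtain ⟨K, hK⟩ := (hgt (T - N.time e) (by linarith [N.time_pos e])).exists
    have := (Finset.eventually_all (Finset.range K)).mpr
      fun k (_ : k ∈ Finset.range K) => P.eventually_t_ne (P.t k + N.time e)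
    filter_upwards [this] with n hn k
    rcases lt_or_ge k K with h | h
    · exact hn k (Finset.mem_range.mpr h)
    · have := P.t_strictMono.monotone h
      linarith [hlt (n + 1)]
  obtain ⟨n, h1, h2, h3, h4⟩ :=
    (hno.and (hone.and (hJ.and (eventually_all.mpr hbr)))).exists
  rcases P.event n with h | ⟨e, he, he'⟩ | ⟨e, he, he'⟩ | h | ⟨k, _, e, h⟩
  · exact h2 h
  · exact he ((h1 e).1 he')
  · exact he ((h1 e).2 he')
  · exact h3 h
  · exact h4 e k h

end PhaseSeq

lemma intervalIntegrable_of_eq_const {g : ℝ → ℝ} {a b c : ℝ} (hab : a ≤ b)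
    (h : ∀ θ ∈ Ioo a b, g θ = c) : IntervalIntegrable g volume a b := by
  refine (intervalIntegrable_const (c := c)).congr_uIoo fun θ hθ => ?_
  rw [uIoo_of_le hab] at hθ
  exact (h θ hθ).symm

lemma integral_of_eq_const {g : ℝ → ℝ} {a b c : ℝ} (hab : a ≤ b)
    (h : ∀ θ ∈ Ioo a b, g θ = c) : ∫ ζ in a..b, g ζ = (b - a) * c := by
  rw [intervalIntegral.integral_congr_Ioo_of_le hab (g := fun _ => c) h]
  simp

lemma affine_nonneg {a d r Δ : ℝ} (ha : 0 ≤ a) (h : 0 ≤ a + Δ * d) (hr : 0 ≤ r) (hrΔ : r ≤ Δ) :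
    0 ≤ a + r * d := by
  rcases le_total 0 d with hd | hd
  · positivity
  · nlinarith

namespace PhaseSeq

variable {N : Network V E} (P : PhaseSeq N)

lemma exists_lt_t (θ : ℝ) : ∃ n, θ < P.t (n + 1) :=
  ((Filter.tendsto_add_atTop_nat 1).eventually (P.tendsto_t.eventually_gt_atTop θ)).exists

lemma exists_phase {θ : ℝ} (hθ : 0 ≤ θ) : ∃ n, P.t n ≤ θ ∧ θ < P.t (n + 1) := by
  classical
  refine ⟨Nat.find (P.exists_lt_t θ), ?_, Nat.find_spec (P.exists_lt_t θ)⟩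
  rcases h : Nat.find (P.exists_lt_t θ) with _ | n
  · rwa [P.t_zero]
  · exact not_lt.mp (Nat.find_min (P.exists_lt_t θ) (h ▸ n.lt_succ_self))

lemma t_nonneg (n : ℕ) : 0 ≤ P.t n := P.t_zero ▸ P.t_strictMono.monotone n.zero_le

open Classical in
/-- The inflow rates of the edges. -/
noncomputable def inRate (e : E) (θ : ℝ) : ℝ :=
  if θ < 0 then 0 else P.x (Nat.find (P.exists_lt_t θ)) e

/-- The outflow rates of the edges. -/
noncomputable def outRate (e : E) (θ : ℝ) : ℝ := P.Y e (θ - N.time e)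

lemma inRate_eq {n : ℕ} {θ : ℝ} (h1 : P.t n ≤ θ) (h2 : θ < P.t (n + 1)) (e : E) :
    P.inRate e θ = P.x n e := by
  classical
  rw [inRate, if_neg (not_lt.mpr ((P.t_nonneg n).trans h1))]
  congr
  refine (Nat.find_eq_iff _).mpr ⟨h2, fun k hk => not_lt.mpr (le_trans ?_ h1)⟩
  exact P.t_strictMono.monotone hk

lemma inRate_nonneg (e : E) (θ : ℝ) : 0 ≤ P.inRate e θ := by
  unfold inRate
  split_ifs
  · exact le_rfl
  · exact (P.routing _).nonneg e

lemma Y_nonneg (e : E) (θ : ℝ) : 0 ≤ P.Y e θ := by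
  rcases lt_or_ge θ 0 with h | h
  · exact (P.Y_neg e θ h).ge
  · obtain ⟨n, h1, h2⟩ := P.exists_phase h
    rw [P.Y_eq e n θ h1 h2]
    exact sub_nonneg.mpr (queueRate_le (N.cap_pos e) ((P.routing n).nonneg e))

lemma Y_const {n : ℕ} {θ : ℝ} (h1 : P.t n ≤ θ) (h2 : θ < P.t (n + 1)) (e : E) :
    P.Y e (θ - N.time e) = P.Y e (P.t n - N.time e) := by
  rcases lt_or_ge (θ - N.time e) 0 with h | h
  · rw [P.Y_neg _ _ h, P.Y_neg _ _ (by linarith)]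
  · obtain ⟨k, h3, h4⟩ := P.exists_phase h
    have hk : k < n + 1 :=
      P.t_strictMono.lt_iff_lt.mp (by linarith [N.time_pos e])
    have : P.t k + N.time e ≤ P.t n := by
      by_contra hcon
      linarith [P.break_le n k e (Nat.lt_succ_iff.mp hk) (not_le.mp hcon)]
    rw [P.Y_eq e k _ h3 h4, P.Y_eq e k _ (by linarith) (by linarith)]

lemma conservation {θ : ℝ} (hθ : 0 ≤ θ) {v : V} (hv : v ≠ N.sink) :
    ∑ e ∈ N.outEdges v, P.inRate e θ = N.u v θ + ∑ e ∈ N.inEdges v, P.outRate e θ := by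
  obtain ⟨n, h1, h2⟩ := P.exists_phase hθ
  simp only [P.inRate_eq h1 h2, outRate, P.Y_const h1 h2, P.u_const v n θ h1 h2]
  exact (P.routing n).conserve v hv

lemma intervalIntegrable_of_const {g : ℝ → ℝ} {c : ℕ → ℝ} (hneg : ∀ θ < 0, g θ = 0)
    (hg : ∀ n θ, P.t n ≤ θ → θ < P.t (n + 1) → g θ = c n) (θ : ℝ) :
    IntervalIntegrable g volume 0 θ := by
  rcases le_total θ 0 with h | h
  · exact (intervalIntegrable_of_eq_const h fun ζ hζ => hneg ζ hζ.2).symm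
  · obtain ⟨n, h1, h2⟩ := P.exists_phase h
    refine IntervalIntegrable.trans (b := P.t n) ?_
      (intervalIntegrable_of_eq_const h1 fun ζ hζ => hg n ζ hζ.1.le (hζ.2.trans h2))
    rw [← P.t_zero]
    exact IntervalIntegrable.trans_iterate fun k _ =>
      intervalIntegrable_of_eq_const (P.t_lt k).le fun ζ hζ => hg k ζ hζ.1.le hζ.2

lemma inRate_int (e : E) (θ : ℝ) : IntervalIntegrable (P.inRate e) volume 0 θ :=
  P.intervalIntegrable_of_const (c := fun n => P.x n e)
    (fun θ h => by rw [inRate, if_pos h]) (fun _ _ h1 h2 => P.inRate_eq h1 h2 e) θ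

lemma Y_int (e : E) (θ : ℝ) : IntervalIntegrable (P.Y e) volume 0 θ :=
  P.intervalIntegrable_of_const (P.Y_neg e) (P.Y_eq e) θ

lemma outRate_int (e : E) (θ : ℝ) : IntervalIntegrable (P.outRate e) volume 0 θ := by
  have := ((P.Y_int e (0 - N.time e)).symm.trans (P.Y_int e (θ - N.time e))).comp_sub_right
    (N.time e)
  rwa [sub_add_cancel, sub_add_cancel] at this

/-- The flow over time described by a phase sequence. -/
noncomputable def flow : FlowOverTime N where
  fplus := P.inRate
  fminus := P.outRate
  fplus_nonneg := P.inRate_nonneg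
  fminus_nonneg := fun e _ => P.Y_nonneg e _
  fplus_int := P.inRate_int
  fminus_int := P.outRate_int

/-- The queue at time `θ`, extrapolated from phase `n`. -/
noncomputable def queueAt (n : ℕ) (θ : ℝ) (e : E) : ℝ :=
  P.q n e + (θ - P.t n) * queueRates N (P.q n) (P.x n) e

lemma integral_outRate (e : E) (θ : ℝ) :
    ∫ ζ in (0:ℝ)..(θ + N.time e), P.outRate e ζ = ∫ ζ in (0:ℝ)..θ, P.Y e ζ := by
  have hτ : (0:ℝ) - N.time e ≤ 0 := by linarith [N.time_pos e]
  simp only [outRate]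
  rw [intervalIntegral.integral_comp_sub_right, add_sub_cancel_right,
    ← intervalIntegral.integral_add_adjacent_intervals (P.Y_int e _).symm (P.Y_int e θ),
    integral_of_eq_const hτ fun ζ hζ => P.Y_neg e ζ hζ.2]
  simp

lemma queueOf_eq {n : ℕ} {θ : ℝ} (h1 : P.t n ≤ θ) (h2 : θ < P.t (n + 1)) (e : E) :
    queueOf N P.flow.fplus P.flow.fminus e θ = P.queueAt n θ e := by
  set G : ℝ → ℝ := fun ζ => P.inRate e ζ - P.Y e ζ with hG
  have hGeq : ∀ k ζ, P.t k ≤ ζ → ζ < P.t (k + 1) → G ζ = queueRates N (P.q k) (P.x k) e := by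
    intro k ζ h1 h2
    simp only [hG]
    rw [P.inRate_eq h1 h2, P.Y_eq e k ζ h1 h2]
    ring
  have hGint : ∀ θ, IntervalIntegrable G volume 0 θ := fun θ =>
    (P.inRate_int e θ).sub (P.Y_int e θ)
  have hq : queueOf N P.flow.fplus P.flow.fminus e θ = ∫ ζ in (0:ℝ)..θ, G ζ := by
    simp only [hG]
    rw [intervalIntegral.integral_sub (P.inRate_int e θ) (P.Y_int e θ), ← P.integral_outRate]
    rfl
  have hn : ∀ k, ∫ ζ in (0:ℝ)..(P.t k), G ζ = P.q k e := by
    intro k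
    induction k with
    | zero => simp [P.t_zero, P.q_zero]
    | succ k ih =>
      rw [← intervalIntegral.integral_add_adjacent_intervals (hGint (P.t k))
        ((hGint _).symm.trans (hGint _)), ih, P.q_succ,
        integral_of_eq_const (P.t_lt k).le fun ζ hζ => hGeq k ζ hζ.1.le hζ.2]
  rw [hq, ← intervalIntegral.integral_add_adjacent_intervals (hGint (P.t n))
    ((hGint _).symm.trans (hGint _)), hn,
    integral_of_eq_const h1 fun ζ hζ => hGeq n ζ hζ.1.le (hζ.2.trans h2), queueAt]

lemma queueAt_nonneg {n : ℕ} {θ : ℝ} (h1 : P.t n ≤ θ) (h2 : θ < P.t (n + 1)) (e : E) :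
    0 ≤ P.queueAt n θ e :=
  affine_nonneg (P.q_nonneg n e) (P.q_succ n e ▸ P.q_nonneg (n + 1) e)
    (sub_nonneg.mpr h1) (by linarith)

lemma edgeCost_queueAt (n : ℕ) (θ : ℝ) (e : E) :
    edgeCost N (P.queueAt n θ) e =
      edgeCost N (P.q n) e + (θ - P.t n) * (queueRates N (P.q n) (P.x n) e / N.cap e) := by
  simp only [edgeCost, queueAt]
  ring

lemma isPotential_queueAt {n : ℕ} {θ : ℝ} (h1 : P.t n ≤ θ) (h2 : θ < P.t (n + 1)) :
    IsPotential N (edgeCost N (P.queueAt n θ)) fun v => P.l n v + (θ - P.t n) * P.s n v where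
  sink := by rw [(P.pot n).sink, (P.routing n).sink]; ring
  le e := by
    have h3 := P.slack_succ n e
    have h4 := affine_nonneg (sub_nonneg.mpr ((P.pot n).le e))
      (h3 ▸ sub_nonneg.mpr ((P.pot (n + 1)).le e)) (sub_nonneg.mpr h1)
      (sub_le_sub_right h2.le _)
    rw [edgeCost_queueAt]
    linarith
  tight v hv := by
    obtain ⟨e, he, rfl, hs⟩ := (P.routing n).tight v hv
    refine ⟨e, rfl, ?_⟩
    rw [edgeCost_queueAt, mem_activeEdges.mp he, hs, queueRates]
    ring

lemma ctimeOf_eq {n : ℕ} {θ : ℝ} (h1 : P.t n ≤ θ) (h2 : θ < P.t (n + 1)) (e : E) :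
    ctimeOf N P.flow.fplus P.flow.fminus e θ = edgeCost N (P.queueAt n θ) e := by
  rw [ctimeOf, P.queueOf_eq h1 h2, edgeCost]

lemma labelOf_eq {n : ℕ} {θ : ℝ} (h1 : P.t n ≤ θ) (h2 : θ < P.t (n + 1)) (v : V) :
    labelOf N P.flow.fplus P.flow.fminus v θ = P.l n v + (θ - P.t n) * P.s n v := by
  simp only [labelOf, P.ctimeOf_eq h1 h2]
  exact (P.isPotential_queueAt h1 h2).sInf_eq (edgeCost_pos N (P.queueAt_nonneg h1 h2)) v

lemma queueOf_nonneg (e : E) {θ : ℝ} (hθ : 0 ≤ θ) :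
    0 ≤ queueOf N P.flow.fplus P.flow.fminus e θ := by
  obtain ⟨n, h1, h2⟩ := P.exists_phase hθ
  exact P.queueOf_eq h1 h2 e ▸ P.queueAt_nonneg h1 h2 e

lemma Y_eq_ite {n : ℕ} {θ : ℝ} (h1 : P.t n ≤ θ) (h2 : θ < P.t (n + 1)) (e : E) :
    P.Y e θ = if 0 < P.queueAt n θ e then N.cap e else min (P.x n e) (N.cap e) := by
  have hend := P.q_succ n e ▸ P.q_nonneg (n + 1) e
  have hqn := P.q_nonneg n e
  rw [P.Y_eq e n θ h1 h2]
  simp only [queueAt]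
  by_cases hz : e ∈ emptyQueues (P.q n)
  · simp only [queueRates, queueRate, if_pos hz, mem_emptyQueues.mp hz]
    split_ifs with h
    · rcases le_total (P.x n e) (N.cap e) with hx | hx
      · rw [max_eq_right (by linarith)] at h
        linarith
      · rw [max_eq_left (by linarith)]
        ring
    · rcases le_total (P.x n e) (N.cap e) with hx | hx
      · rw [max_eq_right (by linarith), min_eq_left hx]
        ring
      · rw [max_eq_left (by linarith), min_eq_right hx]
        ring
  · have hpos : 0 < P.q n e := lt_of_le_of_ne hqn fun h => hz (mem_emptyQueues.mpr h.symm)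
    simp only [queueRates, queueRate, if_neg hz] at hend ⊢
    rw [if_pos]
    · ring
    · rcases le_total 0 (P.x n e - N.cap e) with h | h
      · nlinarith
      · rcases h.lt_or_eq with h | h
        · nlinarith
        · rw [h]
          linarith

lemma isIDE_flow : IsIDE N P.flow := by
  refine ⟨⟨fun v hv θ hθ => ?_, fun θ hθ => ?_, fun e θ _ h => P.Y_neg e _ (by linarith),
    fun e θ hθ => ?_⟩, fun e θ hθ hx => ?_⟩
  · rw [sub_eq_iff_eq_add]
    exact P.conservation hθ hv
  · obtain ⟨n, h1, h2⟩ := P.exists_phase hθ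
    have : ∑ e ∈ N.outEdges N.sink, P.flow.fplus e θ = 0 := by
      refine Finset.sum_eq_zero fun e he => (P.inRate_eq h1 h2 e).trans ?_
      refine (P.routing n).off e fun hA => P.tail_ne_sink hA ?_
      simpa [Network.outEdges] using he
    rw [this, zero_sub, neg_nonpos]
    exact Finset.sum_nonneg fun e _ => P.flow.fminus_nonneg e θ
  · obtain ⟨n, h1, h2⟩ := P.exists_phase hθ
    rw [P.queueOf_eq h1 h2, show P.flow.fplus e θ = P.x n e from P.inRate_eq h1 h2 e,
      ← P.Y_eq_ite h1 h2]
    simp [flow, outRate]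
  · obtain ⟨n, h1, h2⟩ := P.exists_phase hθ
    have hx' : 0 < P.x n e := P.inRate_eq h1 h2 e ▸ hx
    have hA : e ∈ activeEdges N (P.q n) (P.l n) := by
      by_contra h
      exact hx'.ne' ((P.routing n).off e h)
    have hs := (P.routing n).slope_eq e hA hx'
    rw [ActiveOf, P.labelOf_eq h1 h2, P.labelOf_eq h1 h2, P.ctimeOf_eq h1 h2, edgeCost_queueAt,
      mem_activeEdges.mp hA, hs, queueRates]
    ring

end PhaseSeq

namespace FlowOverTime

open Filter Topology

variable {N : Network V E} (f : FlowOverTime N)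

/-- The cumulative inflow of an edge. -/
noncomputable def inCum (e : E) (θ : ℝ) : ℝ := ∫ ζ in (0:ℝ)..θ, f.fplus e ζ

/-- The cumulative outflow of an edge. -/
noncomputable def outCum (e : E) (θ : ℝ) : ℝ := ∫ ζ in (0:ℝ)..θ, f.fminus e ζ

lemma monotone_primitive {g : ℝ → ℝ} (hg : ∀ θ, 0 ≤ g θ)
    (hi : ∀ θ, IntervalIntegrable g volume 0 θ) : Monotone fun θ => ∫ ζ in (0:ℝ)..θ, g ζ := by
  intro a b hab
  have := intervalIntegral.integral_interval_sub_left (hi b) (hi a)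
  have h2 : 0 ≤ ∫ ζ in a..b, g ζ := intervalIntegral.integral_nonneg hab fun ζ _ => hg ζ
  simp only
  linarith

lemma inCum_mono (e : E) : Monotone (f.inCum e) :=
  monotone_primitive (f.fplus_nonneg e) (f.fplus_int e)

lemma outCum_mono (e : E) : Monotone (f.outCum e) :=
  monotone_primitive (f.fminus_nonneg e) (f.fminus_int e)

lemma queueOf_eq_sub (e : E) (θ : ℝ) :
    queueOf N f.fplus f.fminus e θ = f.inCum e θ - f.outCum e (θ + N.time e) := rfl

variable {f}

lemma inCum_eq_of_fplus_eq_zero {e : E} {T : ℝ} (hT : ∀ θ, T ≤ θ → f.fplus e θ = 0) {θ : ℝ}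
    (hθ : T ≤ θ) : f.inCum e θ = f.inCum e T := by
  rw [inCum, ← intervalIntegral.integral_add_adjacent_intervals (f.fplus_int e T)
    ((f.fplus_int e T).symm.trans (f.fplus_int e θ)),
    integral_of_eq_const hθ fun ζ hζ => hT ζ hζ.1.le, mul_zero, add_zero, inCum]

lemma exists_inCum_le (hf : IsIDE N f) (e : E) {θ : ℝ} (hθ : 0 ≤ θ) :
    ∃ θ', θ ≤ θ' ∧ f.inCum e θ ≤ f.outCum e (θ' + N.time e) := by
  by_contra! hcon
  have hν : ∀ θ', θ ≤ θ' → f.fminus e (θ' + N.time e) = N.cap e := fun θ' h => by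
    rw [hf.1.2.2.2 e θ' (hθ.trans h), if_pos]
    rw [queueOf_eq_sub]
    linarith [hcon θ' h, f.inCum_mono e h]
  have hν' : ∀ ζ, θ + N.time e ≤ ζ → f.fminus e ζ = N.cap e := fun ζ h => by
    have := hν (ζ - N.time e) (by linarith)
    rwa [sub_add_cancel] at this
  set D := f.inCum e θ - f.outCum e (θ + N.time e)
  have hD : 0 < D := sub_pos.mpr (hcon θ le_rfl)
  have hle : θ ≤ θ + D / N.cap e := by linarith [div_pos hD (N.cap_pos e)]
  have h1 := hcon _ hle
  have h2 : f.outCum e (θ + D / N.cap e + N.time e) = f.outCum e (θ + N.time e) + D := by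
    rw [outCum, ← intervalIntegral.integral_add_adjacent_intervals
      (f.fminus_int e (θ + N.time e)) ((f.fminus_int e _).symm.trans (f.fminus_int e _)),
      integral_of_eq_const (by linarith) fun ζ hζ => hν' ζ hζ.1.le, outCum]
    have := N.cap_pos e
    field_simp
    ring
  rw [h2] at h1
  linarith

lemma inCum_le_of_outCum_le (hf : IsIDE N f) {e : E} {B : ℝ}
    (hB : ∀ θ, 0 ≤ θ → f.outCum e θ ≤ B) {θ : ℝ} (hθ : 0 ≤ θ) : f.inCum e θ ≤ B := by
  obtain ⟨θ', h1, h2⟩ := exists_inCum_le hf e hθ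
  exact h2.trans (hB _ (by linarith [N.time_pos e]))

lemma eventually_fminus_eq_zero (hf : IsIDE N f) {e : E}
    (h : ∀ᶠ θ in atTop, f.fplus e θ = 0) : ∀ᶠ θ in atTop, f.fminus e θ = 0 := by
  obtain ⟨T, hT⟩ := eventually_atTop.mp (h.and (eventually_ge_atTop 0))
  obtain ⟨θ', h1, h2⟩ := exists_inCum_le hf e (hT T le_rfl).2
  filter_upwards [eventually_ge_atTop (θ' + N.time e)] with ζ hζ
  have hθ : T ≤ ζ - N.time e := by linarith
  have h3 := hf.1.2.2.2 e (ζ - N.time e) (hT _ hθ).2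
  rw [sub_add_cancel, if_neg, (hT _ hθ).1, min_eq_left (N.cap_pos e).le] at h3
  · exact h3
  · rw [queueOf_eq_sub, inCum_eq_of_fplus_eq_zero (fun θ h => (hT θ h).1) hθ,
      sub_add_cancel]
    linarith [f.outCum_mono e hζ]

lemma eventually_queueOf_lt (hf : IsIDE N f) {e : E} {B : ℝ}
    (hB : ∀ θ, 0 ≤ θ → f.outCum e θ ≤ B) {ε : ℝ} (hε : 0 < ε) :
    ∀ᶠ θ in atTop, queueOf N f.fplus f.fminus e θ < ε := by
  have hbd : BddAbove (f.outCum e '' Ici 0) := ⟨B, by rintro _ ⟨θ, hθ, rfl⟩; exact hB θ hθ⟩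
  have hle : ∀ θ, 0 ≤ θ → f.outCum e θ ≤ sSup (f.outCum e '' Ici 0) := fun θ hθ =>
    le_csSup hbd ⟨θ, hθ, rfl⟩
  obtain ⟨_, ⟨T, hT, rfl⟩, h⟩ := exists_lt_of_lt_csSup (s := f.outCum e '' Ici 0)
    ⟨_, 0, mem_Ici.mpr le_rfl, rfl⟩ (sub_lt_self _ hε)
  filter_upwards [eventually_ge_atTop T] with θ hθ
  have h1 := inCum_le_of_outCum_le hf hle (le_trans hT hθ)
  have h2 := f.outCum_mono e (show T ≤ θ + N.time e by linarith [N.time_pos e])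
  rw [queueOf_eq_sub]
  linarith

lemma outCum_le_inCum (hq : ∀ e θ, 0 ≤ θ → 0 ≤ queueOf N f.fplus f.fminus e θ)
    (e : E) {θ : ℝ} (hθ : 0 ≤ θ) : f.outCum e θ ≤ f.inCum e θ := by
  have h1 := hq e θ hθ
  rw [queueOf_eq_sub] at h1
  have := f.outCum_mono e (show θ ≤ θ + N.time e by linarith [N.time_pos e])
  linarith

lemma isPotential_labelOf (hq : ∀ e θ, 0 ≤ θ → 0 ≤ queueOf N f.fplus f.fminus e θ)
    {θ : ℝ} (hθ : 0 ≤ θ) :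
    IsPotential N (fun e => ctimeOf N f.fplus f.fminus e θ)
      (fun v => labelOf N f.fplus f.fminus v θ) := by
  have hc : ∀ e, 0 < ctimeOf N f.fplus f.fminus e θ := fun e =>
    add_pos_of_pos_of_nonneg (N.time_pos e) (div_nonneg (hq e θ hθ) (N.cap_pos e).le)
  obtain ⟨π, hπ⟩ := exists_isPotential N hc
  rwa [show (fun v => labelOf N f.fplus f.fminus v θ) = π from funext fun v => hπ.sInf_eq hc v]

lemma fplus_eq_zero_of_tail_eq_sink (hq : ∀ e θ, 0 ≤ θ → 0 ≤ queueOf N f.fplus f.fminus e θ)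
    (hf : IsIDE N f) {e : E} (he : N.tail e = N.sink) {θ : ℝ}
    (hθ : 0 ≤ θ) : f.fplus e θ = 0 := by
  by_contra h
  refine (isPotential_labelOf hq hθ).tail_ne_sink (fun e => ?_)
    (hf.2 e θ hθ (lt_of_le_of_ne (f.fplus_nonneg e θ) (Ne.symm h))) he
  exact add_pos_of_pos_of_nonneg (N.time_pos e) (div_nonneg (hq e θ hθ) (N.cap_pos e).le)

lemma exists_net_inflow_bound (hbdd : N.BddInflow) (hf : IsIDE N f) {v : V} (hv : v ≠ N.sink) :
    ∃ C, ∀ θ, 0 ≤ θ →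
      0 ≤ ∑ e ∈ N.outEdges v, f.inCum e θ - ∑ e ∈ N.inEdges v, f.outCum e θ ∧
      ∑ e ∈ N.outEdges v, f.inCum e θ - ∑ e ∈ N.inEdges v, f.outCum e θ ≤ C := by
  set g : ℝ → ℝ := fun θ =>
    ∑ e ∈ N.outEdges v, f.fplus e θ - ∑ e ∈ N.inEdges v, f.fminus e θ with hg
  have hi1 : ∀ θ, IntervalIntegrable (fun ζ => ∑ e ∈ N.outEdges v, f.fplus e ζ) volume 0 θ :=
    fun θ => by
      have := IntervalIntegrable.sum (N.outEdges v) (f := f.fplus) fun e _ => f.fplus_int e θ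
      rwa [Finset.sum_fn] at this
  have hi2 : ∀ θ, IntervalIntegrable (fun ζ => ∑ e ∈ N.inEdges v, f.fminus e ζ) volume 0 θ :=
    fun θ => by
      have := IntervalIntegrable.sum (N.inEdges v) (f := f.fminus) fun e _ => f.fminus_int e θ
      rwa [Finset.sum_fn] at this
  have hi : ∀ θ, IntervalIntegrable g volume 0 θ := fun θ => (hi1 θ).sub (hi2 θ)
  have hG : ∀ θ, ∑ e ∈ N.outEdges v, f.inCum e θ - ∑ e ∈ N.inEdges v, f.outCum e θ
      = ∫ ζ in (0:ℝ)..θ, g ζ := fun θ => by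
    simp only [hg]
    rw [intervalIntegral.integral_sub (hi1 θ) (hi2 θ),
      intervalIntegral.integral_finsetSum fun e _ => f.fplus_int e θ,
      intervalIntegral.integral_finsetSum fun e _ => f.fminus_int e θ]
    rfl
  have hgu : ∀ θ, 0 ≤ θ → g θ = N.u v θ := fun θ hθ => hf.1.1 v hv θ hθ
  have hgn : ∀ a b, 0 ≤ a → a ≤ b → 0 ≤ ∫ ζ in a..b, g ζ := fun a b ha hab =>
    intervalIntegral.integral_nonneg hab fun ζ hζ =>
      hgu ζ (ha.trans hζ.1) ▸ N.u_nonneg v ζ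
  obtain ⟨B, hB⟩ := hbdd v
  set B' := max B 0
  refine ⟨∫ ζ in (0:ℝ)..B', g ζ, fun θ hθ => ?_⟩
  rw [hG]
  refine ⟨hgn 0 θ le_rfl hθ, ?_⟩
  rcases le_total θ B' with h | h
  · have := intervalIntegral.integral_interval_sub_left (hi B') (hi θ)
    linarith [hgn θ B' hθ h]
  · have := intervalIntegral.integral_interval_sub_left (hi θ) (hi B')
    have h0 : ∫ ζ in B'..θ, g ζ = (θ - B') * 0 := integral_of_eq_const h fun ζ hζ => by
      rw [hgu ζ ((le_max_right B 0).trans hζ.1.le)]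
      exact hB ζ ((le_max_left B 0).trans hζ.1.le)
    linarith

lemma exists_sink_bound (hq : ∀ e θ, 0 ≤ θ → 0 ≤ queueOf N f.fplus f.fminus e θ)
    (hbdd : N.BddInflow) (hf : IsIDE N f) :
    ∃ C, ∀ θ, 0 ≤ θ → ∑ e ∈ N.inEdges N.sink, f.outCum e θ ≤ C := by
  have hC : ∀ v, ∃ C, ∀ θ, 0 ≤ θ → v ≠ N.sink →
      ∑ e ∈ N.outEdges v, f.inCum e θ - ∑ e ∈ N.inEdges v, f.outCum e θ ≤ C := fun v => by
    by_cases hv : v = N.sink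
    · exact ⟨0, fun _ _ h => absurd hv h⟩
    · obtain ⟨C, hC⟩ := exists_net_inflow_bound hbdd hf hv
      exact ⟨C, fun θ hθ _ => (hC θ hθ).2⟩
  choose C hC using hC
  refine ⟨∑ v ∈ Finset.univ.erase N.sink, C v, fun θ hθ => ?_⟩
  have h1 : ∑ e, f.inCum e θ = ∑ v, ∑ e ∈ N.outEdges v, f.inCum e θ :=
    (Finset.sum_fiberwise Finset.univ N.tail fun e => f.inCum e θ).symm
  have h2 : ∑ e, f.outCum e θ = ∑ v, ∑ e ∈ N.inEdges v, f.outCum e θ :=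
    (Finset.sum_fiberwise Finset.univ N.head fun e => f.outCum e θ).symm
  have h3 : ∑ e, f.outCum e θ ≤ ∑ e, f.inCum e θ :=
    Finset.sum_le_sum fun e _ => outCum_le_inCum hq e hθ
  have h4 : ∑ e ∈ N.outEdges N.sink, f.inCum e θ = 0 := Finset.sum_eq_zero fun e he => by
    have he : N.tail e = N.sink := by simpa [Network.outEdges] using he
    rw [inCum, integral_of_eq_const hθ fun ζ hζ =>
      fplus_eq_zero_of_tail_eq_sink hq hf he hζ.1.le, mul_zero]
  have h5 := Finset.sum_le_sum fun v (hv : v ∈ Finset.univ.erase N.sink) =>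
    hC v θ hθ (Finset.ne_of_mem_erase hv)
  rw [Finset.sum_sub_distrib] at h5
  rw [h1, h2, ← Finset.add_sum_erase _ _ (Finset.mem_univ N.sink),
    ← Finset.add_sum_erase _ _ (Finset.mem_univ N.sink), h4] at h3
  linarith

/-- With bounded inflows, an IDE eventually only uses shortest paths with respect to the
travel times without queues. -/
lemma eventually_tight (hq : ∀ e θ, 0 ≤ θ → 0 ≤ queueOf N f.fplus f.fminus e θ)
    (hbdd : N.BddInflow) (hf : IsIDE N f) {d : V → ℝ}
    (hd : IsPotential N N.time d) {e : E} (he : d (N.tail e) ≠ N.time e + d (N.head e)) :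
    ∀ᶠ θ in atTop, f.fplus e θ = 0 := by
  have hdl : ∀ v θ, 0 ≤ θ → d v ≤ labelOf N f.fplus f.fminus v θ := fun v θ hθ =>
    hd.mono (isPotential_labelOf hq hθ)
      (fun e => add_pos_of_pos_of_nonneg (N.time_pos e)
        (div_nonneg (hq e θ hθ) (N.cap_pos e).le))
      (fun e => le_add_of_nonneg_right (div_nonneg (hq e θ hθ) (N.cap_pos e).le)) v
  have hstep : ∀ e, d (N.tail e) ≠ N.time e + d (N.head e) →
      (∀ ε > 0, ∀ᶠ θ in atTop, labelOf N f.fplus f.fminus (N.tail e) θ < d (N.tail e) + ε) →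
      ∀ᶠ θ in atTop, f.fplus e θ = 0 := fun e he h => by
    have hlt := lt_of_le_of_ne (hd.le e) he
    filter_upwards [h _ (sub_pos.mpr hlt), eventually_ge_atTop 0] with θ h1 hθ
    by_contra hne
    have hA := hf.2 e θ hθ (lt_of_le_of_ne (f.fplus_nonneg e θ) (Ne.symm hne))
    rw [ActiveOf, ctimeOf] at hA
    linarith [hdl (N.head e) θ hθ, div_nonneg (hq e θ hθ) (N.cap_pos e).le]
  suffices H : ∀ v, (∃ B, ∀ e, N.head e = v → ∀ θ, 0 ≤ θ → f.outCum e θ ≤ B) ∧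
      ∀ ε > 0, ∀ᶠ θ in atTop, labelOf N f.fplus f.fminus v θ < d v + ε from
    hstep e he (H _).2
  have wf : WellFounded (fun a b : V => d a < d b) :=
    (Finite.wellFounded_of_trans_of_irrefl _ : WellFounded (fun a b : V => d a < d b))
  have hsingle : ∀ v B θ, ∑ e ∈ N.inEdges v, f.outCum e θ ≤ B → 0 ≤ θ →
      ∀ e, N.head e = v → f.outCum e θ ≤ B := fun v B θ hB hθ e he =>
    le_trans (Finset.single_le_sum (f := fun e => f.outCum e θ) (fun e _ =>
      intervalIntegral.integral_nonneg hθ fun ζ _ => f.fminus_nonneg e ζ)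
      (by simpa [Network.inEdges] using he)) hB
  intro v
  induction v using wf.induction with
  | _ v ih =>
  by_cases hv : v = N.sink
  · subst hv
    obtain ⟨C, hC⟩ := exists_sink_bound hq hbdd hf
    refine ⟨⟨C, fun e he θ hθ => hsingle _ C θ (hC θ hθ) hθ e he⟩, fun ε hε => ?_⟩
    filter_upwards [eventually_ge_atTop 0] with θ hθ
    have := (isPotential_labelOf hq hθ).sink
    rw [hd.sink]
    linarith
  · have hlab : ∀ ε > 0, ∀ᶠ θ in atTop, labelOf N f.fplus f.fminus v θ < d v + ε := by
      intro ε hε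
      obtain ⟨e, rfl, hde⟩ := hd.tight v hv
      obtain ⟨⟨B, hB⟩, hl⟩ := ih (N.head e) (by linarith [N.time_pos e])
      filter_upwards [hl (ε / 2) (by linarith), eventually_ge_atTop 0,
        eventually_queueOf_lt hf (hB e rfl) (mul_pos (half_pos hε) (N.cap_pos e))]
        with θ h1 hθ h2
      have h3 := (isPotential_labelOf hq hθ).le e
      have h4 : queueOf N f.fplus f.fminus e θ / N.cap e < ε / 2 :=
        (div_lt_iff₀ (N.cap_pos e)).mpr h2
      simp only [ctimeOf] at h3
      linarith
    refine ⟨?_, hlab⟩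
    have hin : ∀ e, ∃ B, N.tail e = v → ∀ θ, 0 ≤ θ → f.inCum e θ ≤ B := fun e => by
      by_cases hev : N.tail e = v
      · subst hev
        by_cases hde : d (N.tail e) = N.time e + d (N.head e)
        · obtain ⟨⟨B, hB⟩, -⟩ := ih (N.head e) (by linarith [N.time_pos e])
          exact ⟨B, fun _ θ hθ => inCum_le_of_outCum_le hf (hB e rfl) hθ⟩
        · obtain ⟨T, hT⟩ := eventually_atTop.mp (hstep e hde hlab)
          refine ⟨f.inCum e T, fun _ θ _ => ?_⟩
          rcases le_total θ T with h | h
          · exact f.inCum_mono e h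
          · exact (inCum_eq_of_fplus_eq_zero hT h).le
      · exact ⟨0, fun h => absurd h hev⟩
    choose B hB using hin
    obtain ⟨C, hC⟩ := exists_net_inflow_bound hbdd hf hv
    refine ⟨∑ e ∈ N.outEdges v, B e, fun e he θ hθ => hsingle v _ θ ?_ hθ e he⟩
    refine (sub_nonneg.mp (hC θ hθ).1).trans (Finset.sum_le_sum fun e he => hB e ?_ θ hθ)
    simpa [Network.outEdges] using he

/-- With bounded inflows, all flow of an IDE eventually has reached the sink. -/
lemma eventually_eq_zero (hq : ∀ e θ, 0 ≤ θ → 0 ≤ queueOf N f.fplus f.fminus e θ)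
    (hbdd : N.BddInflow) (hf : IsIDE N f) :
    ∀ᶠ θ in atTop, ∀ e, f.fplus e θ = 0 ∧ f.fminus e θ = 0 := by
  obtain ⟨d, hd⟩ := exists_isPotential N N.time_pos
  suffices H : ∀ v e, N.head e = v → ∀ᶠ θ in atTop, f.fplus e θ = 0 ∧ f.fminus e θ = 0 from
    eventually_all.mpr fun e => H _ e rfl
  have wf : WellFounded (fun a b : V => d b < d a) :=
    (Finite.wellFounded_of_trans_of_irrefl _ : WellFounded (fun a b : V => d b < d a))
  intro v
  induction v using wf.induction with
  | _ v ih =>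
  rintro e rfl
  suffices hp : ∀ᶠ θ in atTop, f.fplus e θ = 0 from
    hp.and (eventually_fminus_eq_zero hf hp)
  by_cases he : d (N.tail e) = N.time e + d (N.head e)
  · by_cases hs : N.tail e = N.sink
    · filter_upwards [eventually_ge_atTop 0] with θ hθ
      exact fplus_eq_zero_of_tail_eq_sink hq hf hs hθ
    · obtain ⟨B, hB⟩ := hbdd (N.tail e)
      have hin : ∀ᶠ θ in atTop, ∀ a, N.head a = N.tail e → f.fminus a θ = 0 := by
        refine eventually_all.mpr fun a => ?_
        by_cases ha : N.head a = N.tail e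
        · exact (ih _ (by linarith [N.time_pos e]) a ha).mono fun θ h _ => h.2
        · exact Eventually.of_forall fun θ h => absurd h ha
      filter_upwards [hin, eventually_ge_atTop 0, eventually_ge_atTop B] with θ h1 hθ h2
      have h3 := hf.1.1 _ hs θ hθ
      have h4 : ∑ a ∈ N.inEdges (N.tail e), f.fminus a θ = 0 :=
        Finset.sum_eq_zero fun a ha => h1 a (by simpa [Network.inEdges] using ha)
      rw [hB θ h2, h4, sub_zero,
        Finset.sum_eq_zero_iff_of_nonneg fun a _ => f.fplus_nonneg a θ] at h3
      exact h3 e (by simp [Network.outEdges])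
  · exact eventually_tight hq hbdd hf hd he

end FlowOverTime

lemma exists_sorted_partition (S : Finset ℝ) (h0 : 0 ∈ S) (hS : ∀ p ∈ S, 0 ≤ p) :
    ∃ (n : ℕ) (t : ℕ → ℝ), t 0 = 0 ∧ (∀ i < n, t i < t (i + 1)) ∧
      (∀ i < n, ∀ p ∈ S, t i < p → t (i + 1) ≤ p) ∧ (∀ p ∈ S, p ≤ t n) ∧ ∀ i ≤ n, 0 ≤ t i := by
  obtain ⟨n, hn⟩ : ∃ n, S.card = n + 1 :=
    Nat.exists_eq_succ_of_ne_zero (Finset.card_pos.mpr ⟨0, h0⟩).ne'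
  let g := S.orderEmbOfFin hn
  have hg : ∀ p ∈ S, ∃ j, g j = p := fun p hp => by
    have : p ∈ range g := by rw [Finset.range_orderEmbOfFin]; exact hp
    exact this
  have hmem : ∀ j, g j ∈ S := fun j => S.orderEmbOfFin_mem hn j
  have ht : ∀ i (hi : i ≤ n), (Fin.ofNat (n + 1) i : Fin (n + 1)) = ⟨i, Nat.lt_succ_of_le hi⟩ :=
    fun i hi => Fin.ext (Nat.mod_eq_of_lt (Nat.lt_succ_of_le hi))
  refine ⟨n, fun i => g (Fin.ofNat (n + 1) i), ?_, fun i hi => ?_, fun i hi p hp h => ?_,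
    fun p hp => ?_, fun i _ => hS _ (hmem _)⟩
  · obtain ⟨j, hj⟩ := hg 0 h0
    refine le_antisymm ?_ (hS _ (hmem _))
    rw [← hj]
    exact g.monotone (Fin.zero_le j)
  · simp only [ht i hi.le, ht (i + 1) hi, g.lt_iff_lt]
    exact Nat.lt_succ_self i
  · obtain ⟨j, rfl⟩ := hg p hp
    simp only [ht i hi.le, ht (i + 1) hi, g.lt_iff_lt, g.le_iff_le] at h ⊢
    exact h
  · obtain ⟨j, rfl⟩ := hg p hp
    simp only [ht n le_rfl]
    exact g.monotone (Fin.le_last j)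

lemma aeConstOn_of_forall {g : ℝ → ℝ} {S : Set ℝ} (hS : MeasurableSet S) {c : ℝ}
    (h : ∀ θ ∈ S, g θ = c) : AEConstOn g S :=
  ⟨c, (ae_restrict_iff' hS).mpr (Filter.Eventually.of_forall h)⟩

lemma PhaseSeq.exists_phasePartition {N : Network V E} (P : PhaseSeq N) {T : ℝ}
    (hT : ∀ θ, T ≤ θ → ∀ e, P.flow.fplus e θ = 0 ∧ P.flow.fminus e θ = 0) :
    ∃ n t, PhasePartition N P.flow n t := by
  obtain ⟨K, hK⟩ := (P.tendsto_t.eventually_ge_atTop T).exists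
  have hzero : ∀ θ, P.t K ≤ θ → ∀ e, P.flow.fplus e θ = 0 ∧ P.flow.fminus e θ = 0 :=
    fun θ hθ => hT θ (hK.trans hθ)
  set R := Finset.range (K + 1)
  set S : Finset ℝ := R.image P.t ∪ (R ×ˢ Finset.univ).image fun p : ℕ × E => P.t p.1 + N.time p.2
  have hS1 : ∀ k ≤ K, P.t k ∈ S := fun k hk => Finset.mem_union_left _
    (Finset.mem_image_of_mem _ (Finset.mem_range.mpr (Nat.lt_succ_of_le hk)))
  have hS2 : ∀ k ≤ K, ∀ e, P.t k + N.time e ∈ S := fun k hk e => Finset.mem_union_right _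
    (Finset.mem_image.mpr ⟨(k, e), by simp [R, Nat.lt_succ_of_le hk], rfl⟩)
  have hS0 : ∀ p ∈ S, 0 ≤ p := fun p hp => by
    rcases Finset.mem_union.mp hp with h | h
    · obtain ⟨k, _, rfl⟩ := Finset.mem_image.mp h
      exact P.t_nonneg k
    · obtain ⟨k, _, rfl⟩ := Finset.mem_image.mp h
      exact add_nonneg (P.t_nonneg _) (N.time_pos _).le
  obtain ⟨n, t, h0, hlt, hgap, hlast, hnn⟩ :=
    exists_sorted_partition S (P.t_zero ▸ hS1 0 K.zero_le) hS0
  refine ⟨n, t, h0, hlt, fun i hi e => ?_⟩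
  unfold phaseSeg
  split_ifs with hin
  · have hKlt : ∀ {a k}, P.t k ≤ a → a < P.t K → k + 1 ≤ K := fun h1 h2 =>
      P.t_strictMono.lt_iff_lt.mp (h1.trans_lt h2)
    rcases le_or_gt (P.t K) (t i) with hle | hgt
    · exact ⟨aeConstOn_of_forall measurableSet_Ioo fun θ hθ =>
          (hzero θ (hle.trans hθ.1.le) e).1,
        aeConstOn_of_forall measurableSet_Ioo fun θ hθ => (hzero θ (hle.trans hθ.1.le) e).2⟩
    · constructor
      · obtain ⟨k, h1, h2⟩ := P.exists_phase (hnn i hi)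
        have h3 := hgap i hin _ (hS1 (k + 1) (hKlt h1 hgt)) h2
        exact aeConstOn_of_forall measurableSet_Ioo fun θ hθ =>
          P.inRate_eq (h1.trans hθ.1.le) (hθ.2.trans_le h3) e
      · have hτ := N.time_pos e
        rcases lt_or_ge (t i - N.time e) 0 with hneg | hpos
        · have h3 := hgap i hin _ (hS2 0 K.zero_le e) (by rw [P.t_zero]; linarith)
          rw [P.t_zero] at h3
          exact aeConstOn_of_forall measurableSet_Ioo fun θ hθ =>
            P.Y_neg e _ (by linarith [hθ.2])
        · obtain ⟨k, h1, h2⟩ := P.exists_phase hpos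
          have h3 := hgap i hin _ (hS2 (k + 1) (hKlt h1 (by linarith)) e) (by linarith)
          exact aeConstOn_of_forall measurableSet_Ioo fun θ hθ =>
            P.Y_eq e k _ (by linarith [hθ.1]) (by linarith [hθ.2])
  · have hle := hlast _ (hS1 K le_rfl)
    exact ⟨aeConstOn_of_forall measurableSet_Ioi fun θ hθ =>
        (hzero θ (hle.trans (mem_Ioi.mp hθ).le) e).1,
      aeConstOn_of_forall measurableSet_Ioi fun θ hθ =>
        (hzero θ (hle.trans (mem_Ioi.mp hθ).le) e).2⟩

/-- Every single-sink network (on an arbitrary finite directed graph,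
with right-constant piecewise constant inflow rates with finitely many jump points and
bounded support) admits an IDE flow with only finitely many phases; in particular all
edge in- and outflow rates of this IDE are piecewise constant with finitely many pieces. -/
theorem ide_with_finitely_many_phases
    {V E : Type} [Fintype V] [DecidableEq V] [Fintype E] [DecidableEq E]
    (N : Network V E) (hbdd : N.BddInflow) :
    ∃ f : FlowOverTime N, IsIDE N f ∧ ∃ (n : ℕ) (t : ℕ → ℝ), PhasePartition N f n t := by
  obtain ⟨P⟩ := exists_phaseSeq N
  obtain ⟨T, hT⟩ := Filter.eventually_atTop.mp
    (FlowOverTime.eventually_eq_zero (fun e _ hθ => P.queueOf_nonneg e hθ) hbdd P.isIDE_flow)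
  exact ⟨P.flow, P.isIDE_flow, P.exists_phasePartition hT⟩
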